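/- arXiv:2305.08011 — 2 statements merged into one kernel-verified Lean document; each statement's English description precedes it below -/
import Mathlib

section
/- Let G₁ and G₂ be discrete convergence groups acting on a compact metrizable space M, suppose J = G₁ ∩ G₂ is geometrically finite and a proper subgroup of both G₁ and G₂, suppose G₁ and G₂ are in AFP ping-pong position with respect to J with closed sets B₁, B₂, and let G = ⟨G₁, G₂⟩ act on M as a convergence group. Then: (i) Λ(J) ⊆ ∂B₁ ∩ ∂B₂ (in particular, if J is infinite then ∂B₁ ∩ ∂B₂ ≠ ∅); (ii) for i ∈ {1,2}, Λ(G_i) ⊆ B_{3−i}; (iii) for i ∈ {1,2} and any g ∈ G ∖ G_i, g Λ(G_i) ∩ Λ(G_i) = ∅. -/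
open Filter Topology Set

namespace ConvergenceGroups

variable {M : Type*} [TopologicalSpace M]

/-- The group of self-homeomorphisms of `M`, with `(g * h) x = g (h x)`. -/
instance : Group (M ≃ₜ M) where
  mul g h := h.trans g
  one := Homeomorph.refl M
  inv := Homeomorph.symm
  mul_assoc _ _ _ := rfl
  one_mul _ := Homeomorph.ext fun _ => rfl
  mul_one _ := Homeomorph.ext fun _ => rfl
  inv_mul_cancel g := Homeomorph.ext fun x => g.symm_apply_apply x

/-- The inclusion of the self-homeomorphisms of `M` into the continuous self-maps of `M`;
the latter carries the compact-open topology. -/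
def toCM (g : M ≃ₜ M) : C(M, M) := ⟨⇑g, g.continuous⟩

/-- `(g k)` is a convergence sequence with attracting point `zp` and repelling point `zm`:
the maps `g k` converge to the constant map `zp` uniformly on compact subsets of
`M ∖ {zm}`. -/
def IsConvSeq (g : ℕ → M ≃ₜ M) (zp zm : M) : Prop :=
  ∀ K : Set M, IsCompact K → zm ∉ K → ∀ U ∈ 𝓝 zp,
    ∀ᶠ k in atTop, ∀ x ∈ K, g k x ∈ U

/-- `(g k)` converges in the compact-open topology to a homeomorphism. -/
def TendstoHomeo (g : ℕ → M ≃ₜ M) : Prop :=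
  ∃ h : M ≃ₜ M, Tendsto (fun k => toCM (g k)) atTop (𝓝 (toCM h))

/-- `G` acts on `M` as a convergence group: every sequence of pairwise distinct elements of
`G` has a subsequence which either converges in the compact-open topology to a
homeomorphism, or is a convergence sequence. -/
def IsConvGroup (G : Subgroup (M ≃ₜ M)) : Prop :=
  ∀ g : ℕ → M ≃ₜ M, (∀ k, g k ∈ G) → Function.Injective g →
    ∃ φ : ℕ → ℕ, StrictMono φ ∧
      (TendstoHomeo (g ∘ φ) ∨ ∃ zp zm : M, IsConvSeq (g ∘ φ) zp zm)

/-- `G` acts on `M` as a discrete convergence group: every sequence of pairwise distinct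
elements of `G` has a subsequence which is a convergence sequence. -/
def IsDiscreteConvGroup (G : Subgroup (M ≃ₜ M)) : Prop :=
  ∀ g : ℕ → M ≃ₜ M, (∀ k, g k ∈ G) → Function.Injective g →
    ∃ φ : ℕ → ℕ, StrictMono φ ∧ ∃ zp zm : M, IsConvSeq (g ∘ φ) zp zm

/-- The limit set `Λ(G)`: the set of all attracting points of convergence sequences in `G`. -/
def limitSet (G : Subgroup (M ≃ₜ M)) : Set M :=
  {zp | ∃ g : ℕ → M ≃ₜ M, (∀ k, g k ∈ G) ∧ Function.Injective g ∧
    ∃ zm : M, IsConvSeq g zp zm}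

/-- `x` is a conical limit point for `G`: there is a sequence of pairwise distinct elements
`g k` of `G` such that for every `z ≠ x` the pairs `(g k x, g k z)` remain in a compact
subset of `(M × M) ∖ Δ`. -/
def IsConicalLimitPt (G : Subgroup (M ≃ₜ M)) (x : M) : Prop :=
  ∃ g : ℕ → M ≃ₜ M, (∀ k, g k ∈ G) ∧ Function.Injective g ∧
    ∀ z : M, z ≠ x → ∃ K : Set (M × M), IsCompact K ∧ (∀ p ∈ K, p.1 ≠ p.2) ∧
      ∀ k, (g k x, g k z) ∈ K

/-- `g` is elliptic: the closure of the cyclic group generated by `g` is compact in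
`Homeo(M)` (viewed inside `C(M, M)` with the compact-open topology). -/
def IsEllipticElem (g : M ≃ₜ M) : Prop :=
  IsCompact (closure (Set.range fun n : ℤ => toCM (g ^ n))) ∧
    closure (Set.range fun n : ℤ => toCM (g ^ n)) ⊆ Set.range (toCM (M := M))

/-- `g` is parabolic: not elliptic, and fixes exactly one point of `M`. -/
def IsParabolicElem (g : M ≃ₜ M) : Prop :=
  ¬IsEllipticElem g ∧ ∃! x : M, g x = x

/-- `g` is loxodromic: not elliptic, and fixes exactly two points of `M`. -/
def IsLoxodromicElem (g : M ≃ₜ M) : Prop :=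
  ¬IsEllipticElem g ∧ ∃ a b : M, a ≠ b ∧ {x : M | g x = x} = {a, b}

/-- `p` is a parabolic point for `G`: it is the fixed point of a parabolic element of `G`. -/
def IsParabolicPt (G : Subgroup (M ≃ₜ M)) (p : M) : Prop :=
  ∃ g ∈ G, IsParabolicElem g ∧ g p = p

/-- `p` is a bounded parabolic point for `G`: it is a parabolic point and the quotient of
`Λ(G) ∖ {p}` by the stabilizer of `p` in `G` is compact. -/
def IsBoundedParabolicPt (G : Subgroup (M ≃ₜ M)) (p : M) : Prop :=
  IsParabolicPt G p ∧
    ∃ K : Set M, IsCompact K ∧ K ⊆ limitSet G \ {p} ∧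
      ∀ x ∈ limitSet G \ {p}, ∃ h ∈ G, h p = p ∧ h x ∈ K

/-- `G` is geometrically finite: every point of `Λ(G)` is a conical limit point or a
bounded parabolic point. -/
def IsGeomFinite (G : Subgroup (M ≃ₜ M)) : Prop :=
  ∀ x ∈ limitSet G, IsConicalLimitPt G x ∨ IsBoundedParabolicPt G x

/-- `J` is a fully quasi-convex subgroup of `G`: `J ≤ G`, `J` acts geometrically finitely,
and `g Λ(J) ∩ Λ(J) = ∅` for all but finitely many left cosets `gJ`. -/
def IsFullyQuasiconvex (G J : Subgroup (M ≃ₜ M)) : Prop :=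
  J ≤ G ∧ IsGeomFinite J ∧
    ∃ F : Set (M ≃ₜ M), F.Finite ∧ ∀ g ∈ G,
      (⇑g '' limitSet J ∩ limitSet J).Nonempty → ∃ f ∈ F, ∃ j ∈ J, g = f * j

/-- `G₁` and `G₂` are in AFP ping-pong position with respect to `J = G₁ ∩ G₂`, witnessed by
the closed sets `B₁`, `B₂`. -/
structure AFPPingPong (G₁ G₂ J : Subgroup (M ≃ₜ M)) (B₁ B₂ : Set M) : Prop where
  isClosed₁ : IsClosed B₁
  isClosed₂ : IsClosed B₂
  int_nonempty₁ : (interior B₁).Nonempty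
  int_nonempty₂ : (interior B₂).Nonempty
  int_disjoint : interior B₁ ∩ interior B₂ = ∅
  inv₁ : ∀ j ∈ J, ⇑j '' B₁ = B₁
  inv₂ : ∀ j ∈ J, ⇑j '' B₂ = B₂
  pp₁ : ∀ g ∈ G₁, g ∉ J → ⇑g '' B₁ ⊆ interior B₂
  pp₂ : ∀ g ∈ G₂, g ∉ J → ⇑g '' B₂ ⊆ interior B₁
  lim₁ : limitSet G₁ \ limitSet J ⊆ interior B₂
  lim₂ : limitSet G₂ \ limitSet J ⊆ interior B₁

/-- `G₀` is in HNN ping-pong position with respect to `f`, `J₁`, `J₋₁`, witnessed by the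
closed sets `B₁`, `Bm` (where `Bm` plays the role of `B₋₁`). -/
structure HNNPingPong (G₀ J₁ Jm : Subgroup (M ≃ₜ M)) (f : M ≃ₜ M) (B₁ Bm : Set M) :
    Prop where
  isClosed₁ : IsClosed B₁
  isClosedm : IsClosed Bm
  int_nonempty₁ : (interior B₁).Nonempty
  int_nonemptym : (interior Bm).Nonempty
  int_disjoint : interior B₁ ∩ interior Bm = ∅
  inv₁ : ∀ j ∈ J₁, ⇑j '' B₁ = B₁
  invm : ∀ j ∈ Jm, ⇑j '' Bm = Bm
  prec₁ : ∀ g ∈ G₀, g ∉ J₁ → ⇑g '' B₁ ∩ B₁ = ∅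
  precm : ∀ g ∈ G₀, g ∉ Jm → ⇑g '' Bm ∩ Bm = ∅
  cross : ∀ g ∈ G₀, ⇑g '' B₁ ∩ Bm = ∅
  mapf : ⇑f '' ((B₁ ∪ Bm)ᶜ ∪ B₁) = interior B₁
  lim₁ : limitSet G₀ ∩ B₁ = limitSet J₁
  limm : limitSet G₀ ∩ Bm = limitSet Jm
  proper : (⋃ g ∈ G₀, ⇑g '' (B₁ ∪ Bm))ᶜ.Nonempty

/-- A letter of type `i` (`i = 0` for `G₁`, `i = 1` for `G₂`) for amalgamated free product
normal forms: an element of `G_{i+1} ∖ J`. -/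
def AFPLetter (G₁ G₂ J : Subgroup (M ≃ₜ M)) (i : Fin 2) (g : M ≃ₜ M) : Prop :=
  g ∈ (if i = 0 then G₁ else G₂) ∧ g ∉ J

/-- `h` is an `(i,j)`-form: a product of a nonempty alternating list of letters, whose first
letter lies in `G_i ∖ J` and whose last letter lies in `G_j ∖ J` (indices shifted so that
`0` stands for `G₁` and `1` for `G₂`). -/
def IsIJForm (G₁ G₂ J : Subgroup (M ≃ₜ M)) (i j : Fin 2) (h : M ≃ₜ M) : Prop :=
  ∃ l : List (M ≃ₜ M), l ≠ [] ∧ l.prod = h ∧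
    (∀ g ∈ l, AFPLetter G₁ G₂ J 0 g ∨ AFPLetter G₁ G₂ J 1 g) ∧
    l.Chain' (fun a b => ∀ c : Fin 2, AFPLetter G₁ G₂ J c a → AFPLetter G₁ G₂ J (1 - c) b) ∧
    (∀ hne : l ≠ [], AFPLetter G₁ G₂ J i (l.head hne)) ∧
    (∀ hne : l ≠ [], AFPLetter G₁ G₂ J j (l.getLast hne))

theorem mul_apply' (g h : M ≃ₜ M) (x : M) : (g * h) x = g (h x) := rfl

theorem inv_apply_apply (g : M ≃ₜ M) (x : M) : g⁻¹ (g x) = x := g.symm_apply_apply x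

theorem infinite_of_injective_seq {g : ℕ → M ≃ₜ M} (hg : Function.Injective g) : Infinite M := by
  by_contra h
  rw [not_infinite_iff_finite] at h
  have : Finite (M ≃ₜ M) := Finite.of_injective (fun f : M ≃ₜ M => (f : M → M)) DFunLike.coe_injective
  exact not_injective_infinite_finite g hg

/-- The inverses of a convergence sequence form a convergence sequence, with the attracting and
repelling points exchanged. -/
theorem IsConvSeq.inv [CompactSpace M] [T2Space M] {g : ℕ → M ≃ₜ M} {zp zm : M}
    (h : IsConvSeq g zp zm) : IsConvSeq (fun k => (g k)⁻¹) zm zp := by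
  intro K hK hzp U hU
  obtain ⟨V, hVU, hV, hzV⟩ := mem_nhds_iff.1 hU
  filter_upwards [h Vᶜ hV.isClosed_compl.isCompact (fun hz => hz hzV) Kᶜ
    (hK.isClosed.isOpen_compl.mem_nhds hzp)] with k hk x hx
  by_contra hxU
  refine hk ((g k)⁻¹ x) (fun hxV => hxU (hVU hxV)) ?_
  rwa [show g k ((g k)⁻¹ x) = x from (g k).apply_symm_apply x]

theorem IsConvSeq.eventually_mem [T2Space M] {g : ℕ → M ≃ₜ M} {zp zm : M}
    (h : IsConvSeq g zp zm) {x : M} (hx : x ≠ zm) {U : Set M} (hU : U ∈ 𝓝 zp) :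
    ∀ᶠ k in atTop, g k x ∈ U :=
  (h {x} isCompact_singleton (fun hz => hx hz.symm) U hU).mono fun _ hk => hk x rfl

theorem IsConvSeq.const_mul {g : ℕ → M ≃ₜ M} {zp zm : M} (h : IsConvSeq g zp zm) (f : M ≃ₜ M) :
    IsConvSeq (fun k => f * g k) (f zp) zm :=
  fun K hK hzm _ hU => h K hK hzm _ (f.continuous.continuousAt hU)

/-- The attracting point of a convergence sequence in an infinite space is not isolated. -/
theorem IsConvSeq.not_isOpen_singleton [T2Space M] [Infinite M] {g : ℕ → M ≃ₜ M} {zp zm : M}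
    (h : IsConvSeq g zp zm) : ¬IsOpen ({zp} : Set M) := by
  intro ho
  obtain ⟨x, hx⟩ := Infinite.exists_notMem_finset ({zm} : Finset M)
  classical
  obtain ⟨y, hy⟩ := Infinite.exists_notMem_finset ({zm, x} : Finset M)
  simp only [Finset.mem_singleton, Finset.mem_insert, not_or] at hx hy
  obtain ⟨k, hkx, hky⟩ := ((h.eventually_mem hx (ho.mem_nhds rfl)).and
    (h.eventually_mem hy.1 (ho.mem_nhds rfl))).exists
  exact hy.2 ((g k).injective (hky.trans hkx.symm))

theorem apply_mem_limitSet {G : Subgroup (M ≃ₜ M)} {f : M ≃ₜ M} (hf : f ∈ G) {x : M}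
    (hx : x ∈ limitSet G) : f x ∈ limitSet G := by
  obtain ⟨g, hgG, hg, zm, h⟩ := hx
  exact ⟨fun k => f * g k, fun k => G.mul_mem hf (hgG k), fun a b hab => hg (mul_left_cancel hab),
    zm, h.const_mul f⟩

theorem limitSet_nonempty {G H : Subgroup (M ≃ₜ M)} (hd : IsDiscreteConvGroup G) (hHG : H ≤ G)
    (hH : (H : Set (M ≃ₜ M)).Infinite) : (limitSet H).Nonempty := by
  let g := hH.natEmbedding
  have hg : Function.Injective fun k => (g k : M ≃ₜ M) :=
    Subtype.val_injective.comp g.injective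
  obtain ⟨φ, hφ, zp, zm, h⟩ := hd (fun k => (g k : M ≃ₜ M)) (fun k => hHG (g k).2) hg
  exact ⟨zp, _, fun k => (g (φ k)).2, hg.comp hφ.injective, zm, h⟩

/-- The limit set of `J` lies in the closure of every nonempty open set preserved by `J`. -/
theorem limitSet_subset_closure [CompactSpace M] [T2Space M] {J : Subgroup (M ≃ₜ M)} {U : Set M}
    (hU : IsOpen U) (hne : U.Nonempty) (hinv : ∀ j ∈ J, ∀ x ∈ U, j x ∈ U) :
    limitSet J ⊆ closure U := by
  rintro z ⟨g, hgJ, hg, zm, h⟩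
  have := infinite_of_injective_seq hg
  obtain ⟨b, hb, hbz⟩ : ∃ b ∈ U, b ≠ zm := by
    by_contra! hall
    refine h.inv.not_isOpen_singleton ?_
    rwa [← hne.subset_singleton_iff.1 hall]
  rw [mem_closure_iff_nhds]
  intro V hV
  obtain ⟨k, hk⟩ := (h.eventually_mem hbz hV).exists
  exact ⟨g k b, hk, hinv _ (hgJ k) b hb⟩

theorem AFPPingPong.symm {G₁ G₂ J : Subgroup (M ≃ₜ M)} {B₁ B₂ : Set M}
    (h : AFPPingPong G₁ G₂ J B₁ B₂) : AFPPingPong G₂ G₁ J B₂ B₁ :=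
  ⟨h.isClosed₂, h.isClosed₁, h.int_nonempty₂, h.int_nonempty₁, by rw [inter_comm, h.int_disjoint],
    h.inv₂, h.inv₁, h.pp₂, h.pp₁, h.lim₂, h.lim₁⟩

theorem AFPPingPong.limitSet_subset_closure_interior [CompactSpace M] [T2Space M]
    {G₁ G₂ J : Subgroup (M ≃ₜ M)} {B₁ B₂ : Set M} (h : AFPPingPong G₁ G₂ J B₁ B₂) :
    limitSet J ⊆ closure (interior B₁) := by
  refine limitSet_subset_closure isOpen_interior h.int_nonempty₁ fun j hj x hx => ?_
  have := j.image_interior B₁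
  rw [h.inv₁ j hj] at this
  exact this ▸ mem_image_of_mem j hx

theorem AFPPingPong.limitSet_subset_frontier [CompactSpace M] [T2Space M]
    {G₁ G₂ J : Subgroup (M ≃ₜ M)} {B₁ B₂ : Set M} (h : AFPPingPong G₁ G₂ J B₁ B₂) :
    limitSet J ⊆ frontier B₁ := by
  refine fun x hx => ⟨closure_mono interior_subset (h.limitSet_subset_closure_interior hx),
    fun hxi => ?_⟩
  obtain ⟨y, hy⟩ := mem_closure_iff.1 (h.symm.limitSet_subset_closure_interior hx) _
    isOpen_interior hxi
  exact (h.int_disjoint ▸ hy : y ∈ (∅ : Set M))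

theorem AFPPingPong.limitSet_subset [CompactSpace M] [T2Space M]
    {G₁ G₂ J : Subgroup (M ≃ₜ M)} {B₁ B₂ : Set M} (h : AFPPingPong G₁ G₂ J B₁ B₂) :
    limitSet G₁ ⊆ B₂ := by
  intro x hx
  by_cases hxJ : x ∈ limitSet J
  · exact h.isClosed₂.frontier_subset (h.symm.limitSet_subset_frontier hxJ)
  · exact interior_subset (h.lim₁ ⟨hx, hxJ⟩)

theorem AFPPingPong.disjoint_limitSet_interior [CompactSpace M] [T2Space M]
    {G₁ G₂ J : Subgroup (M ≃ₜ M)} {B₁ B₂ : Set M} (h : AFPPingPong G₁ G₂ J B₁ B₂) :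
    Disjoint (limitSet G₁) (interior B₁) := by
  refine Set.disjoint_left.2 fun x hx hxi => ?_
  by_cases hxJ : x ∈ limitSet J
  · exact (h.limitSet_subset_frontier hxJ).2 hxi
  · exact (h.int_disjoint ▸ ⟨hxi, h.lim₁ ⟨hx, hxJ⟩⟩ : x ∈ (∅ : Set M))

/-- Alternating products of elements of `H ∖ K` and `K ∖ H` whose first and last letters lie in
`H ∖ K`. -/
inductive IsAltProd {Γ : Type*} [Group Γ] (K H : Subgroup Γ) : Γ → Prop
  | of {a : Γ} (ha : a ∈ H) (ha' : a ∉ K) : IsAltProd K H a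
  | cons {a k w : Γ} (ha : a ∈ H) (ha' : a ∉ K) (hk : k ∈ K) (hk' : k ∉ H)
      (hw : IsAltProd K H w) : IsAltProd K H (a * (k * w))

/-- Left multiplication by an element of `H` either gives another alternating product, or cancels
the first letter. -/
theorem IsAltProd.mul_left {Γ : Type*} [Group Γ] {K H : Subgroup Γ} {w : Γ}
    (hw : IsAltProd K H w) {a : Γ} (ha : a ∈ H) :
    IsAltProd K H (a * w) ∨ a * w ∈ K ∨ ∃ k ∈ K, ∃ w', IsAltProd K H w' ∧ a * w = k * w' := by
  cases hw with
  | of hb hb' =>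
    by_cases hab : a * w ∈ K
    · exact .inr (.inl hab)
    · exact .inl (.of (H.mul_mem ha hb) hab)
  | @cons b k w' hb hb' hk hk' hv =>
    by_cases hab : a * b ∈ K
    · exact .inr (.inr ⟨a * b * k, K.mul_mem hab hk, w', hv, by group⟩)
    · rw [← mul_assoc]
      exact .inl (.cons (H.mul_mem ha hb) hab hk hk' hv)

/-- Every element of `⟨K, H⟩` lies in `K` or is an alternating product up to multiplication by
elements of `K` on both sides. -/
theorem mem_or_exists_isAltProd_of_mem_sup {Γ : Type*} [Group Γ] {K H : Subgroup Γ} {g : Γ}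
    (hg : g ∈ K ⊔ H) :
    g ∈ K ∨ ∃ k ∈ K, ∃ w, IsAltProd K H w ∧ ∃ l ∈ K, g = k * (w * l) := by
  rw [Subgroup.sup_eq_closure] at hg
  have key : ∀ x ∈ (K : Set Γ) ∪ H, ∀ y : Γ,
      (y ∈ K ∨ ∃ k ∈ K, ∃ w, IsAltProd K H w ∧ ∃ l ∈ K, y = k * (w * l)) →
      (x * y ∈ K ∨ ∃ k ∈ K, ∃ w, IsAltProd K H w ∧ ∃ l ∈ K, x * y = k * (w * l)) := by
    intro x hx y hy
    by_cases hxK : x ∈ K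
    · rcases hy with hy | ⟨k, hk, w, hw, l, hl, rfl⟩
      · exact .inl (K.mul_mem hxK hy)
      · exact .inr ⟨x * k, K.mul_mem hxK hk, w, hw, l, hl, by group⟩
    have hxH : x ∈ H := hx.resolve_left hxK
    rcases hy with hy | ⟨k, hk, w, hw, l, hl, rfl⟩
    · exact .inr ⟨1, K.one_mem, x, .of hxH hxK, y, hy, by group⟩
    by_cases hkH : k ∈ H
    · rcases hw.mul_left (H.mul_mem hxH hkH) with h | h | ⟨k', hk', w', hw', h⟩
      · exact .inr ⟨1, K.one_mem, _, h, l, hl, by group⟩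
      · exact .inl (by simpa only [mul_assoc] using K.mul_mem h hl)
      · refine .inr ⟨k', hk', w', hw', l, hl, ?_⟩
        rw [← mul_assoc k', ← h]
        group
    · exact .inr ⟨1, K.one_mem, _, .cons hxH hxK hk hkH hw, l, hl, by group⟩
  induction hg using Subgroup.closure_induction_left with
  | one => exact .inl K.one_mem
  | mul_left x hx y _ ih => exact key x hx y ih
  | inv_mul_cancel x hx y _ ih =>
    exact key x⁻¹ (hx.imp (fun h => K.inv_mem h) fun h => H.inv_mem h) y ih

theorem AFPPingPong.apply_mem_interior {G₁ G₂ : Subgroup (M ≃ₜ M)} {B₁ B₂ : Set M}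
    (h : AFPPingPong G₁ G₂ (G₁ ⊓ G₂) B₁ B₂) {w : M ≃ₜ M} (hw : IsAltProd G₁ G₂ w) {x : M}
    (hx : x ∈ B₂) : w x ∈ interior B₁ := by
  induction hw with
  | of ha ha' => exact h.pp₂ _ ha (fun hJ => ha' hJ.1) (mem_image_of_mem _ hx)
  | cons ha ha' hk hk' _ ih =>
    have := h.pp₁ _ hk (fun hJ => hk' hJ.2) (mem_image_of_mem _ (interior_subset ih))
    exact h.pp₂ _ ha (fun hJ => ha' hJ.1) (mem_image_of_mem _ (interior_subset this))

theorem AFPPingPong.image_limitSet_inter [CompactSpace M] [T2Space M]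
    {G₁ G₂ : Subgroup (M ≃ₜ M)} {B₁ B₂ : Set M} (h : AFPPingPong G₁ G₂ (G₁ ⊓ G₂) B₁ B₂)
    {g : M ≃ₜ M} (hg : g ∈ G₁ ⊔ G₂) (hg' : g ∉ G₁) :
    ⇑g '' limitSet G₁ ∩ limitSet G₁ = ∅ := by
  rw [Set.eq_empty_iff_forall_notMem]
  rintro _ ⟨⟨x, hx, rfl⟩, hgx⟩
  obtain ⟨k, hk, w, hw, l, hl, rfl⟩ :=
    (mem_or_exists_isAltProd_of_mem_sup hg).resolve_left hg'
  have hwl : w (l x) ∈ limitSet G₁ := by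
    have := apply_mem_limitSet (G₁.inv_mem hk) hgx
    rwa [mul_apply', mul_apply', inv_apply_apply] at this
  exact Set.disjoint_left.1 h.disjoint_limitSet_interior hwl
    (h.apply_mem_interior hw (h.limitSet_subset (apply_mem_limitSet hl hx)))

/-- Basic properties of the limit sets in the AFP ping-pong situation:
(i) `Λ(J) ⊆ ∂B₁ ∩ ∂B₂` (in particular if `J` is infinite then `∂B₁ ∩ ∂B₂ ≠ ∅`);
(ii) `Λ(G₁) ⊆ B₂` and `Λ(G₂) ⊆ B₁`;
(iii) for `i ∈ {1,2}` and any `g ∈ G ∖ G_i`, `g Λ(G_i) ∩ Λ(G_i) = ∅`. -/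
theorem statement_12 {M : Type*} [TopologicalSpace M] [CompactSpace M]
    [TopologicalSpace.MetrizableSpace M]
    (G₁ G₂ J G : Subgroup (M ≃ₜ M))
    (hd₁ : IsDiscreteConvGroup G₁) (hd₂ : IsDiscreteConvGroup G₂)
    (hJ : J = G₁ ⊓ G₂) (hJgf : IsGeomFinite J) (hJlt₁ : J < G₁) (hJlt₂ : J < G₂)
    (B₁ B₂ : Set M) (hpp : AFPPingPong G₁ G₂ J B₁ B₂)
    (hG : G = G₁ ⊔ G₂) (hGconv : IsConvGroup G) :
    (limitSet J ⊆ frontier B₁ ∩ frontier B₂) ∧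
    ((J : Set (M ≃ₜ M)).Infinite → (frontier B₁ ∩ frontier B₂).Nonempty) ∧
    limitSet G₁ ⊆ B₂ ∧ limitSet G₂ ⊆ B₁ ∧
    (∀ g ∈ G, g ∉ G₁ → ⇑g '' limitSet G₁ ∩ limitSet G₁ = ∅) ∧
    (∀ g ∈ G, g ∉ G₂ → ⇑g '' limitSet G₂ ∩ limitSet G₂ = ∅) := by
  subst hJ hG
  have hpp' : AFPPingPong G₂ G₁ (G₂ ⊓ G₁) B₂ B₁ := inf_comm G₁ G₂ ▸ hpp.symm
  have hfr : limitSet (G₁ ⊓ G₂) ⊆ frontier B₁ ∩ frontier B₂ :=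
    subset_inter hpp.limitSet_subset_frontier hpp.symm.limitSet_subset_frontier
  exact ⟨hfr, fun hinf => (limitSet_nonempty hd₁ inf_le_left hinf).mono hfr, hpp.limitSet_subset,
    hpp.symm.limitSet_subset, fun g hg hg' => hpp.image_limitSet_inter hg hg',
    fun g hg hg' => hpp'.image_limitSet_inter (sup_comm G₁ G₂ ▸ hg) hg'⟩

end ConvergenceGroups
end

section
/- Let G₁ and G₂ be discrete convergence groups acting on a compact metrizable space M, suppose J = G₁ ∩ G₂ is geometrically finite and a proper subgroup of both G₁ and G₂, suppose G₁ and G₂ are in AFP ping-pong position with respect to J with closed sets B₁, B₂, and let G = ⟨G₁, G₂⟩ act on M as a convergence group. Suppose G₁ and G₂ are geometrically finite, and let x be a point of Λ(G) ∖ ⋃_{g ∈ G} g(Λ(G₁) ∪ Λ(G₂)). Then there exists a sequence (g_k) in (G₁ ∪ G₂) ∖ J such that for every k the product h_k = g₁⋯g_k is a normal form of length k (successive letters lie alternately in G₁ ∖ J and G₂ ∖ J), and if g_k ∈ G_j then x ∈ h_k B_j. -/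
open Filter Topology Set

namespace ConvergenceGroups

variable {M : Type*} [TopologicalSpace M]

section Basic

variable {ι κ X : Type*} [TopologicalSpace X]

@[simp] theorem mul_app (g h : X ≃ₜ X) (x : X) : (g * h) x = g (h x) := rfl

@[simp] theorem one_app (x : X) : (1 : X ≃ₜ X) x = x := rfl

@[simp] theorem inv_app_self (g : X ≃ₜ X) (x : X) : g⁻¹ (g x) = x := g.symm_apply_apply x

@[simp] theorem app_inv_self (g : X ≃ₜ X) (x : X) : g (g⁻¹ x) = x := g.apply_symm_apply x

/-- The homeomorphisms `g k` converge along `l` to the constant map `c` locally uniformly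
away from `s`. -/
def ConvAlong (l : Filter ι) (g : ι → X ≃ₜ X) (c s : X) : Prop :=
  ∀ U ∈ 𝓝 c, ∀ V ∈ 𝓝 s, ∀ᶠ k in l, ∀ x, x ∉ V → g k x ∈ U

namespace ConvAlong

variable {l : Filter ι} {g h : ι → X ≃ₜ X} {c s c' s' : X}

theorem comp (hg : ConvAlong l g c s) {l' : Filter κ} {φ : κ → ι} (hφ : Tendsto φ l' l) :
    ConvAlong l' (fun k => g (φ k)) c s :=
  fun U hU V hV => hφ.eventually (hg U hU V hV)

theorem mono (hg : ConvAlong l g c s) {l' : Filter ι} (hl : l' ≤ l) : ConvAlong l' g c s :=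
  hg.comp (φ := id) hl

theorem congr (hg : ConvAlong l g c s) (hgh : ∀ᶠ k in l, g k = h k) : ConvAlong l h c s := by
  intro U hU V hV
  filter_upwards [hg U hU V hV, hgh] with k hk e
  rwa [← e]

theorem inv (hg : ConvAlong l g c s) : ConvAlong l (fun k => (g k)⁻¹) s c := by
  intro U hU V hV
  filter_upwards [hg V hV U hU] with k hk x hx
  by_contra hn
  exact hx (by simpa using hk _ hn)

theorem tendsto [T2Space X] (hg : ConvAlong l g c s) {u : ι → X} {a : X}
    (hu : Tendsto u l (𝓝 a)) (ha : a ≠ s) : Tendsto (fun k => g k (u k)) l (𝓝 c) := by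
  refine tendsto_def.2 fun U hU => ?_
  obtain ⟨A, B, hA, hB, haA, hsB, hAB⟩ := t2_separation ha
  filter_upwards [hg U hU B (hB.mem_nhds hsB), hu.eventually (hA.mem_nhds haA)] with k hk hk'
  exact hk _ fun hb => disjoint_left.1 hAB hk' hb

theorem tendsto_const [T2Space X] (hg : ConvAlong l g c s) {a : X} (ha : a ≠ s) :
    Tendsto (fun k => g k a) l (𝓝 c) :=
  hg.tendsto tendsto_const_nhds ha

theorem mul [T2Space X] (hh : ConvAlong l h c' s') (hg : ConvAlong l g c s) (hne : c ≠ s') :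
    ConvAlong l (fun k => h k * g k) c' s := by
  intro U hU V hV
  obtain ⟨A, B, hA, hB, haA, hsB, hAB⟩ := t2_separation hne
  filter_upwards [hh U hU B (hB.mem_nhds hsB), hg A (hA.mem_nhds haA) V hV] with k hk hk' x hx
  exact hk _ fun hb => disjoint_left.1 hAB (hk' x hx) hb

theorem const_mul (hg : ConvAlong l g c s) (f : X ≃ₜ X) :
    ConvAlong l (fun k => f * g k) (f c) s := by
  intro U hU V hV
  filter_upwards [hg _ (f.continuous.continuousAt hU) V hV] with k hk x hx
  exact hk x hx

theorem mul_const (hg : ConvAlong l g c s) (f : X ≃ₜ X) :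
    ConvAlong l (fun k => g k * f) c (f⁻¹ s) := by
  have := (hg.inv.const_mul f⁻¹).inv
  simpa using this

theorem eventually_ne [T1Space X] [Infinite X] (hg : ConvAlong l g c s) (f : X ≃ₜ X) :
    ∀ᶠ k in l, g k ≠ f := by
  by_contra hf
  rw [not_eventually] at hf
  have key : ∀ x, x ≠ s → f x = c := by
    intro x hx
    by_contra hc
    have h1 := hg {f x}ᶜ (isOpen_compl_singleton.mem_nhds (Ne.symm hc)) {x}ᶜ
      (isOpen_compl_singleton.mem_nhds (Ne.symm hx))
    obtain ⟨k, hk, hk'⟩ := (hf.and_eventually h1).exists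
    have hk2 : g k = f := not_not.1 hk
    exact hk' x (by simp) (by simp [hk2])
  obtain ⟨x, hx⟩ := Set.Infinite.exists_notMem_finite (Set.infinite_univ (α := X))
    (Set.finite_singleton s)
  obtain ⟨y, hy⟩ := Set.Infinite.exists_notMem_finite (Set.infinite_univ (α := X))
    (Set.toFinite {s, x})
  simp only [mem_univ, mem_singleton_iff, true_and, mem_insert_iff, not_or] at hx hy
  exact hy.2 (f.injective ((key y hy.1).trans (key x hx).symm))

end ConvAlong

theorem isConvSeq_iff_convAlong [CompactSpace X] [T2Space X] {g : ℕ → X ≃ₜ X} {c s : X} :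
    IsConvSeq g c s ↔ ConvAlong atTop g c s := by
  constructor
  · intro h U hU V hV
    filter_upwards [h (interior V)ᶜ isOpen_interior.isClosed_compl.isCompact
      (by simpa using mem_interior_iff_mem_nhds.2 hV) U hU] with k hk x hx
    exact hk x fun hx' => hx (interior_subset hx')
  · intro h K hK hs U hU
    filter_upwards [h U hU Kᶜ (hK.isClosed.isOpen_compl.mem_nhds hs)] with k hk x hx
    exact hk x (by simpa using hx)

end Basic

section Metric

variable {ι X : Type*} [MetricSpace X]

theorem exists_injective_convSeq {P : (X ≃ₜ X) → Prop} {c : X}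
    (h : ∀ n : ℕ, ∀ F : Finset (X ≃ₜ X), ∃ f, P f ∧ f ∉ F ∧ ∃ s : X,
      ∀ x, (1 : ℝ) / (n + 1) ≤ dist x s → dist (f x) c < 1 / (n + 1)) :
    ∃ (f : ℕ → X ≃ₜ X) (s : ℕ → X), (∀ n, P (f n)) ∧ Function.Injective f ∧
      ∀ n : ℕ, ∀ x, (1 : ℝ) / (n + 1) ≤ dist x (s n) → dist (f n x) c < 1 / (n + 1) := by
  classical
  obtain ⟨F, hF, hF'⟩ := exists_seq_of_forall_finset_exists
    (P := fun p : ℕ × (X ≃ₜ X) => P p.2 ∧ ∃ s : X,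
      ∀ x, (1 : ℝ) / (p.1 + 1) ≤ dist x s → dist (p.2 x) c < 1 / (p.1 + 1))
    (r := fun p q => p.1 < q.1 ∧ p.2 ≠ q.2) (by
      intro S _
      obtain ⟨f, h1, h2, h3⟩ := h (S.sup Prod.fst + 1) (S.image Prod.snd)
      refine ⟨(S.sup Prod.fst + 1, f), ⟨h1, h3⟩, fun p hp => ⟨?_, ?_⟩⟩
      · exact Nat.lt_succ_of_le (Finset.le_sup (f := Prod.fst) hp)
      · rintro rfl
        exact h2 (Finset.mem_image_of_mem _ hp))
  have hmono : StrictMono fun n => (F n).1 := fun m n hmn => (hF' m n hmn).1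
  choose hP s hs using hF
  refine ⟨fun n => (F n).2, s, hP, ?_, ?_⟩
  · intro m n hmn
    rcases lt_trichotomy m n with h | h | h
    · exact absurd hmn (hF' m n h).2
    · exact h
    · exact absurd hmn.symm (hF' n m h).2
  · intro n x hx
    have hn : (n : ℝ) ≤ (F n).1 := by exact_mod_cast hmono.id_le n
    have hle : (1 : ℝ) / ((F n).1 + 1) ≤ 1 / (n + 1) := by
      apply one_div_le_one_div_of_le <;> [positivity; linarith]
    exact (hs n x (hle.trans hx)).trans_le hle

/-- Quantitative sequences converge along any filter along which the repelling points do. -/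
theorem convAlong_of_tendsto {l : Filter ℕ} (hl : l ≤ atTop) {f : ℕ → X ≃ₜ X} {s : ℕ → X}
    {c a : X}
    (h : ∀ n : ℕ, ∀ x, (1 : ℝ) / (n + 1) ≤ dist x (s n) → dist (f n x) c < 1 / (n + 1))
    (hs : Tendsto s l (𝓝 a)) : ConvAlong l f c a := by
  intro U hU V hV
  obtain ⟨ε, hε, hεU⟩ := Metric.mem_nhds_iff.1 hU
  obtain ⟨δ, hδ, hδV⟩ := Metric.mem_nhds_iff.1 hV
  have h1 : ∀ᶠ n : ℕ in l, (1 : ℝ) / (n + 1) < min ε (δ / 2) :=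
    ((tendsto_one_div_add_atTop_nhds_zero_nat (𝕜 := ℝ)).mono_left hl).eventually_lt_const
      (by positivity)
  filter_upwards [h1, hs (Metric.ball_mem_nhds a (half_pos hδ))] with n hn hn' x hx
  have hx' : δ ≤ dist x a := by
    by_contra hc
    exact hx (hδV (Metric.mem_ball.2 (not_le.1 hc)))
  have hn2 : dist (s n) a < δ / 2 := hn'
  have := dist_triangle x (s n) a
  refine hεU (Metric.mem_ball.2 ((h n x ?_).trans (hn.trans_le (min_le_left _ _))))
  have := hn.trans_le (min_le_right _ _)
  linarith

theorem ConvAlong.eventually_dist {l : Filter ι} {g : ι → X ≃ₜ X} {c s : X}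
    (hg : ConvAlong l g c s) {ε : ℝ} (hε : 0 < ε) :
    ∀ᶠ k in l, ∀ x, ε ≤ dist x s → dist (g k x) c < ε := by
  filter_upwards [hg _ (Metric.ball_mem_nhds c hε) _ (Metric.ball_mem_nhds s hε)] with k hk x hx
  exact hk x (by simpa using hx)

theorem mem_limitSet_of_forall [CompactSpace X] {G : Subgroup (X ≃ₜ X)} {c : X}
    (h : ∀ n : ℕ, ∀ F : Finset (X ≃ₜ X), ∃ f ∈ G, f ∉ F ∧ ∃ s : X,
      ∀ x, (1 : ℝ) / (n + 1) ≤ dist x s → dist (f x) c < 1 / (n + 1)) : c ∈ limitSet G := by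
  obtain ⟨f, s, hf, hinj, hfs⟩ := exists_injective_convSeq (P := fun f => f ∈ G) h
  obtain ⟨a, -, φ, hφ, ha⟩ := isCompact_univ.tendsto_subseq (fun n => mem_univ (s n))
  refine ⟨f ∘ φ, fun k => hf _, hinj.comp hφ.injective, a, isConvSeq_iff_convAlong.2 ?_⟩
  have hmap : Tendsto s (map φ atTop) (𝓝 a) := tendsto_map'_iff.2 ha
  exact (convAlong_of_tendsto hφ.tendsto_atTop hfs hmap).comp tendsto_map

variable [CompactSpace X] [Infinite X] {G H : Subgroup (X ≃ₜ X)}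

theorem mem_limitSet_of_convAlong {l : Filter ι} [NeBot l] {g : ι → X ≃ₜ X} {c s : X}
    (hG : ∀ᶠ k in l, g k ∈ G) (h : ConvAlong l g c s) : c ∈ limitSet G := by
  refine mem_limitSet_of_forall fun n F => ?_
  have hF : ∀ᶠ k in l, ∀ f ∈ F, g k ≠ f :=
    (Finset.eventually_all F).2 fun f _ => h.eventually_ne f
  obtain ⟨k, h1, h2, h3⟩ := (hG.and (hF.and
    (h.eventually_dist (ε := 1 / (n + 1)) (by positivity)))).exists
  exact ⟨g k, h1, fun hk => h2 _ hk rfl, s, h3⟩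

theorem mem_limitSet_of_convAlong_inv {l : Filter ι} [NeBot l] {g : ι → X ≃ₜ X} {c s : X}
    (hG : ∀ᶠ k in l, g k ∈ G) (h : ConvAlong l g c s) : s ∈ limitSet G :=
  mem_limitSet_of_convAlong (hG.mono fun _ hk => G.inv_mem hk) h.inv

omit [Infinite X] in
theorem exists_convAlong_of_mem {c : X} (hc : c ∈ limitSet G) :
    ∃ (g : ℕ → X ≃ₜ X) (s : X), (∀ k, g k ∈ G) ∧ Function.Injective g ∧
      ConvAlong atTop g c s := by
  obtain ⟨g, h1, h2, s, h3⟩ := hc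
  exact ⟨g, s, h1, h2, isConvSeq_iff_convAlong.1 h3⟩

theorem isClosed_limitSet : IsClosed (limitSet G) := by
  refine isClosed_of_closure_subset fun z hz => mem_limitSet_of_forall fun n F => ?_
  have hpos : (0 : ℝ) < 1 / (n + 1) := by positivity
  obtain ⟨c, hc, hzc⟩ := Metric.mem_closure_iff.1 hz _ (half_pos hpos)
  obtain ⟨g, s, h1, -, h⟩ := exists_convAlong_of_mem hc
  have hF : ∀ᶠ k in atTop, ∀ f ∈ F, g k ≠ f :=
    (Finset.eventually_all F).2 fun f _ => h.eventually_ne f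
  obtain ⟨k, h2, h3⟩ := (hF.and (h.eventually_dist (half_pos hpos))).exists
  refine ⟨g k, h1 k, fun hk => h2 _ hk rfl, s, fun x hx => ?_⟩
  have := h3 x ((half_le_self hpos.le).trans hx)
  have := dist_triangle (g k x) c z
  rw [dist_comm z c] at hzc
  linarith

theorem app_mem_limitSet {f : X ≃ₜ X} (hf : f ∈ G) {x : X} (hx : x ∈ limitSet G) :
    f x ∈ limitSet G := by
  obtain ⟨g, s, h1, -, h⟩ := exists_convAlong_of_mem hx
  exact mem_limitSet_of_convAlong (l := atTop)
    (Eventually.of_forall fun k => G.mul_mem hf (h1 k)) (h.const_mul f)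

omit [CompactSpace X] [Infinite X] in
theorem limitSet_mono (h : H ≤ G) : limitSet H ⊆ limitSet G := fun _ ⟨g, h1, h2⟩ =>
  ⟨g, fun k => h (h1 k), h2⟩

omit [CompactSpace X] [Infinite X] in
theorem IsDiscreteConvGroup.mono (hG : IsDiscreteConvGroup G) (h : H ≤ G) :
    IsDiscreteConvGroup H := fun g hg => hG g fun k => h (hg k)

/-- Limit points are not isolated. -/
theorem exists_ne_of_mem_limitSet {a : X} (ha : a ∈ limitSet G) {U : Set X} (hU : U ∈ 𝓝 a) :
    ∃ u ∈ U, u ≠ a := by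
  obtain ⟨g, s, -, -, h⟩ := exists_convAlong_of_mem ha
  obtain ⟨x, hx⟩ := (Set.finite_singleton s).infinite_compl.nonempty
  obtain ⟨y, hy⟩ := (Set.toFinite {s, x}).infinite_compl.nonempty
  simp only [mem_compl_iff, mem_singleton_iff, mem_insert_iff, not_or] at hx hy
  obtain ⟨k, hk1, hk2⟩ :=
    ((h.tendsto_const hx).eventually hU |>.and ((h.tendsto_const hy.1).eventually hU)).exists
  by_cases hc : g k x = a
  · exact ⟨g k y, hk2, fun e => hy.2 ((g k).injective (e.trans hc.symm))⟩
  · exact ⟨g k x, hk1, hc⟩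

omit [Infinite X] in
/-- Along an ultrafilter, elements of a discrete convergence group are either eventually
constant or converge to a constant map away from a point. -/
theorem IsDiscreteConvGroup.const_or_convAlong (hG : IsDiscreteConvGroup G) (𝒰 : Ultrafilter ι)
    (g : ι → X ≃ₜ X) (hg : ∀ᶠ k in 𝒰, g k ∈ G) :
    (∃ h ∈ G, ∀ᶠ k in 𝒰, g k = h) ∨ ∃ c s, ConvAlong 𝒰 g c s := by
  by_contra! hcon
  obtain ⟨hconst, hconv⟩ := hcon
  have h1 : ∀ p : X × X, ∃ U ∈ 𝓝 p.1, ∃ V ∈ 𝓝 p.2, ∀ᶠ k in 𝒰, ¬∀ x, x ∉ V → g k x ∈ U := by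
    intro p
    have := hconv p.1 p.2
    unfold ConvAlong at this
    push Not at this
    obtain ⟨U, hU, V, hV, h⟩ := this
    exact ⟨U, hU, V, hV, h.mono fun k ⟨x, hx, hxU⟩ hall => hxU (hall x hx)⟩
  choose U hU V hV hUV using h1
  obtain ⟨t, ht⟩ := (isCompact_univ (X := X × X)).elim_nhds_subcover
    (fun p => interior (U p) ×ˢ interior (V p))
    (fun p _ => prod_mem_nhds (interior_mem_nhds.2 (hU p)) (interior_mem_nhds.2 (hV p)))
  have hI : ∀ᶠ k in 𝒰, g k ∈ G ∧ ∀ p ∈ t, ¬∀ x, x ∉ V p → g k x ∈ U p :=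
    hg.and ((Finset.eventually_all t).2 fun p _ => hUV p)
  set I := {k | g k ∈ G ∧ ∀ p ∈ t, ¬∀ x, x ∉ V p → g k x ∈ U p} with hIdef
  have hinf : (g '' I).Infinite := by
    intro hfin
    have : ∀ᶠ k in 𝒰, ∃ h ∈ g '' I, g k = h := by
      filter_upwards [hI] with k hk
      exact ⟨g k, ⟨k, hk, rfl⟩, rfl⟩
    rw [Ultrafilter.eventually_exists_mem_iff hfin] at this
    obtain ⟨h, ⟨k, hk, rfl⟩, hh⟩ := this
    obtain ⟨m, hm, hm'⟩ := (hh.and (hconst _ hk.1)).exists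
    exact hm' hm
  obtain ⟨φ, hφ, c, s, hcs⟩ := hG (fun n => (hinf.natEmbedding _ n : X ≃ₜ X))
    (fun n => by
      obtain ⟨k, hk, e⟩ := (hinf.natEmbedding _ n).2
      rw [← e]
      exact hk.1)
    (fun m n e => (hinf.natEmbedding _).injective (Subtype.ext e))
  obtain ⟨p, hp, hcsp⟩ := mem_iUnion₂.1 (ht.2 (mem_univ (c, s)))
  obtain ⟨n, hn⟩ := (isConvSeq_iff_convAlong.1 hcs (U p) (mem_interior_iff_mem_nhds.1 hcsp.1)
    (V p) (mem_interior_iff_mem_nhds.1 hcsp.2)).exists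
  obtain ⟨k, hk, e⟩ := (hinf.natEmbedding _ (φ n)).2
  refine hk.2 p hp ?_
  rw [e]
  exact hn

end Metric

section Shadows

variable {ι X : Type*} [MetricSpace X]

/-- `j ∈ J` separates `w` and `y` by at least `ε`, and the set of points which it moves
`ε / 2`-away from `j w` is minimal among all such elements. -/
def ShadowMinimal (J : Subgroup (X ≃ₜ X)) (w : X) (ε : ℝ) (y : X) (j : X ≃ₜ X) : Prop :=
  MinimalFor (fun j => j ∈ J ∧ ε ≤ dist (j w) (j y))
    (fun j => {x | ε / 2 ≤ dist (j x) (j w)}) j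

theorem eventually_dist_lt {l : Filter ι} {f g : ι → X} {c : X} (hf : Tendsto f l (𝓝 c))
    (hg : Tendsto g l (𝓝 c)) {ε : ℝ} (hε : 0 < ε) : ∀ᶠ k in l, dist (f k) (g k) < ε := by
  have := hf.dist hg
  rw [dist_self] at this
  exact this.eventually_lt_const hε

variable [CompactSpace X] {J : Subgroup (X ≃ₜ X)} {w a b c : X} {ε : ℝ}

theorem exists_tendsto (𝒰 : Ultrafilter ι) (f : ι → X) : ∃ z, Tendsto f 𝒰 (𝓝 z) := by
  obtain ⟨z, -, hz⟩ := isCompact_univ.ultrafilter_le_nhds (𝒰.map f) (by simp)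
  exact ⟨z, hz⟩

variable [Infinite X]

theorem ShadowMinimal.no_return {l : Filter ι} [NeBot l] {y : ι → X} {i j : ι → X ≃ₜ X}
    (hε : 0 < ε) (hj : ∀ᶠ p in l, ShadowMinimal J w ε (y p) (j p))
    (hb : Tendsto (fun p => j p w) l (𝓝 b)) (hab : ε ≤ dist a b) (ha : a ∈ limitSet J)
    (hi : ∀ᶠ p in l, i p ∈ J) (hc : ConvAlong l i c a)
    (hv : ∀ᶠ p in l, ε ≤ dist (i p (j p w)) (i p (j p (y p)))) : False := by
  have hab' : b ≠ a := by
    rintro rfl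
    rw [dist_self] at hab
    linarith
  obtain ⟨u, hu, hua⟩ := exists_ne_of_mem_limitSet ha (Metric.ball_mem_nhds a (ε := ε / 8)
    (by positivity))
  have hib := hc.tendsto hb hab'
  have hiu := hc.tendsto_const hua
  obtain ⟨p, h1, h2, h3, h4, h5, h6, h7⟩ := (hj.and <| hi.and <| hv.and <|
    (hb.eventually (Metric.ball_mem_nhds b (ε := ε / 8) (by positivity))).and <|
    (hib.eventually (Metric.ball_mem_nhds c (ε := ε / 4) (by positivity))).and <|
    (hiu.eventually (Metric.ball_mem_nhds c (ε := ε / 4) (by positivity))).and <|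
    (hc _ (Metric.ball_mem_nhds c (ε := ε / 4) (by positivity))
      _ (Metric.ball_mem_nhds a (ε := ε / 8) (by positivity)))).exists
  rw [Metric.mem_ball] at hu
  have key : ∀ v, dist v a < ε / 8 → ε / 2 ≤ dist v (j p w) := by
    intro v hv
    have := dist_triangle4 a v (j p w) b
    rw [dist_comm a v] at this
    linarith
  have hsub := h1.2 (j := i p * j p) ⟨J.mul_mem h2 h1.1.1, by simpa using h3⟩ (by
    intro x hx
    simp only [mul_app, mem_ofPred_eq] at hx ⊢
    refine key _ ?_
    by_contra hcon
    have h8 : dist (i p (j p x)) c < ε / 4 := by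
      simpa using h7 (j p x) (by simpa using hcon)
    have := dist_triangle_right (i p (j p x)) (i p (j p w)) c
    linarith)
  have hx := hsub (a := (j p)⁻¹ u) (by simpa using key u hu)
  simp only [mul_app, app_inv_self, mem_ofPred_eq] at hx
  have := dist_triangle_right (i p u) (i p (j p w)) c
  linarith

omit [Infinite X] in
theorem const_or_convAlong_of_tendsto (hJ : IsDiscreteConvGroup J) (𝒰 : Ultrafilter ι)
    {t : ι → X ≃ₜ X} (ht : ∀ᶠ k in 𝒰, t k ∈ J) {u v : ι → X} {a' b' : X}
    (hu : Tendsto u 𝒰 (𝓝 b)) (hv : Tendsto v 𝒰 (𝓝 a)) (hab : a ≠ b)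
    (hu' : Tendsto (fun k => t k (u k)) 𝒰 (𝓝 b')) (hv' : Tendsto (fun k => t k (v k)) 𝒰 (𝓝 a'))
    (hab' : a' ≠ b') :
    (∃ h ∈ J, ∀ᶠ k in 𝒰, t k = h) ∨ ConvAlong 𝒰 t b' a ∨ ConvAlong 𝒰 t a' b := by
  obtain h | ⟨c, s, h⟩ := hJ.const_or_convAlong 𝒰 t ht
  · exact Or.inl h
  · right
    by_cases hsa : a = s
    · subst hsa
      rw [tendsto_nhds_unique hu' (h.tendsto hu hab.symm)]
      exact Or.inl h
    · have hc := tendsto_nhds_unique hv' (h.tendsto hv hsa)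
      by_cases hsb : b = s
      · subst hsb
        rw [hc]
        exact Or.inr h
      · exact absurd (hc.trans (tendsto_nhds_unique hu' (h.tendsto hu hsb)).symm) hab'

theorem finite_setOf_le_dist (hJ : IsDiscreteConvGroup J) {y : X} (hw : w ∉ limitSet J)
    (hy : y ∉ limitSet J) (hε : 0 < ε) : {j | j ∈ J ∧ ε ≤ dist (j w) (j y)}.Finite := by
  by_contra hinf
  obtain ⟨f, hf⟩ : ∃ f : ℕ → X ≃ₜ X, Function.Injective f ∧
      ∀ n, f n ∈ J ∧ ε ≤ dist (f n w) (f n y) :=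
    ⟨fun n => Set.Infinite.natEmbedding _ hinf n,
      fun m n h => (Set.Infinite.natEmbedding _ hinf).injective (Subtype.ext h),
      fun n => (Set.Infinite.natEmbedding _ hinf n).2⟩
  obtain ⟨φ, hφ, c, s, h⟩ := hJ f (fun n => (hf.2 n).1) hf.1
  have h := isConvSeq_iff_convAlong.1 h
  have hs : s ∈ limitSet J := mem_limitSet_of_convAlong_inv
    (Eventually.of_forall fun n => (hf.2 (φ n)).1) h
  obtain ⟨n, hn⟩ := (eventually_dist_lt
    (h.tendsto_const (a := w) (fun e => hw (e ▸ hs)))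
    (h.tendsto_const (a := y) (fun e => hy (e ▸ hs))) hε).exists
  exact absurd (hf.2 (φ n)).2 (not_le.2 hn)

theorem exists_shadowMinimal (hJ : IsDiscreteConvGroup J) {y : X} (hw : w ∉ limitSet J)
    (hy : y ∉ limitSet J) (hε : 0 < ε) (hwy : ε ≤ dist w y) :
    ∃ j, ShadowMinimal J w ε y j :=
  (finite_setOf_le_dist hJ hw hy hε).exists_minimalFor _ _ ⟨1, J.one_mem, hwy⟩

end Shadows

section Levels

variable {X : Type*} [MetricSpace X]

/-- Along `𝒰`, the points `y k` can be separated by elements of `J`, applied after arbitrary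
elements `β r` of `J`, from all points different from the limit of the points
`β r (y (κ r))`. -/
def Separates (J : Subgroup (X ≃ₜ X)) (𝒰 : Ultrafilter ℕ) (y : ℕ → X) : Prop :=
  ∀ κ : ℕ → ℕ, Tendsto κ 𝒰 atTop → ∀ β : ℕ → X ≃ₜ X, (∀ r, β r ∈ J) → ∀ a : X,
    Tendsto (fun r => β r (y (κ r))) 𝒰 (𝓝 a) → ∃ ε > 0, ∃ i : ℕ → X ≃ₜ X, (∀ r, i r ∈ J) ∧
      ∃ c, ConvAlong 𝒰 i c a ∧ ∀ᶠ r in 𝒰, ε ≤ dist c (i r (β r (y (κ r))))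

/-- A family of shadow minimal elements at scale `ε`, together with the limits of the images
of `w` and `y k`. -/
structure IsLevel (J : Subgroup (X ≃ₜ X)) (𝒰 : Ultrafilter ℕ) (y : ℕ → X) (w : X) (ε : ℝ)
    (j : ℕ → X ≃ₜ X) (a b : X) : Prop where
  pos : 0 < ε
  mem : ∀ k, j k ∈ J
  minimal : ∀ᶠ k in 𝒰, ShadowMinimal J w ε (y k) (j k)
  tendsto_w : Tendsto (fun k => j k w) 𝒰 (𝓝 b)
  tendsto_y : Tendsto (fun k => j k (y k)) 𝒰 (𝓝 a)
  mem_limitSet : a ∈ limitSet J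
  le_dist : ε ≤ dist a b

variable {J : Subgroup (X ≃ₜ X)} {𝒰 : Ultrafilter ℕ} {y : ℕ → X} {w a b a' b' : X} {ε ε' : ℝ}
  {j j' : ℕ → X ≃ₜ X}

theorem IsLevel.ne (h : IsLevel J 𝒰 y w ε j a b) : a ≠ b := by
  rintro rfl
  have := h.le_dist
  rw [dist_self] at this
  exact this.not_gt h.pos

variable [CompactSpace X] [Infinite X]

theorem Separates.mem_limitSet (h : Separates J 𝒰 y) (h𝒰 : (𝒰 : Filter ℕ) ≤ atTop)
    {β : ℕ → X ≃ₜ X} (hβ : ∀ r, β r ∈ J) (ha : Tendsto (fun r => β r (y r)) 𝒰 (𝓝 a)) :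
    a ∈ limitSet J := by
  obtain ⟨ε, hε, i, hi, c, hc, -⟩ := h id h𝒰 β hβ a ha
  exact mem_limitSet_of_convAlong_inv (Eventually.of_forall hi) hc

theorem exists_isLevel (hJ : IsDiscreteConvGroup J) (h𝒰 : (𝒰 : Filter ℕ) ≤ atTop)
    (hy : ∀ k, y k ∉ limitSet J) (h : Separates J 𝒰 y) :
    ∃ w, ∃ ε₀ > 0, ∀ ε, 0 < ε → ε ≤ ε₀ → ∃ j a b, IsLevel J 𝒰 y w ε j a b := by
  classical
  obtain ⟨a₀, ha₀⟩ := exists_tendsto 𝒰 y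
  have ha₀' : a₀ ∈ limitSet J := h.mem_limitSet h𝒰 (β := fun _ => 1) (fun _ => J.one_mem) ha₀
  have hpos : 0 < dist (y 0) a₀ := dist_pos.2 fun e => hy 0 (e ▸ ha₀')
  have hdist : ∀ᶠ k in 𝒰, dist (y 0) a₀ / 2 ≤ dist (y 0) (y k) :=
    (tendsto_const_nhds.dist ha₀).eventually_const_le (half_lt_self hpos)
  refine ⟨y 0, dist (y 0) a₀ / 2, half_pos hpos, fun ε hε hε' => ?_⟩
  have hex : ∀ k, ∃ j ∈ J, (ε ≤ dist (y 0) (y k) → ShadowMinimal J (y 0) ε (y k) j) := by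
    intro k
    by_cases hk : ε ≤ dist (y 0) (y k)
    · obtain ⟨j, hj⟩ := exists_shadowMinimal hJ (hy 0) (hy k) hε hk
      exact ⟨j, hj.1.1, fun _ => hj⟩
    · exact ⟨1, J.one_mem, fun hk' => absurd hk' hk⟩
  choose j hjJ hj using hex
  obtain ⟨a, ha⟩ := exists_tendsto 𝒰 fun k => j k (y k)
  obtain ⟨b, hb⟩ := exists_tendsto 𝒰 fun k => j k (y 0)
  have hmin : ∀ᶠ k in 𝒰, ShadowMinimal J (y 0) ε (y k) (j k) :=
    hdist.mono fun k hk => hj k (hε'.trans hk)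
  refine ⟨j, a, b, hε, hjJ, hmin, hb, ha, h.mem_limitSet h𝒰 hjJ ha,
    ge_of_tendsto (ha.dist hb) (hmin.mono fun k hk => ?_)⟩
  rw [dist_comm]
  exact hk.1.2

theorem IsLevel.exists_next (hJ : IsDiscreteConvGroup J) (h𝒰 : (𝒰 : Filter ℕ) ≤ atTop)
    (h : Separates J 𝒰 y) (hl : IsLevel J 𝒰 y w ε j a b) :
    ∃ ε₁ > 0, ∀ ε' ≤ ε₁, ∀ j' a' b', IsLevel J 𝒰 y w ε' j' a' b' →
      ConvAlong 𝒰 (fun k => j' k * (j k)⁻¹) b' a := by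
  obtain ⟨δ, hδ, i, hi, c, hc, hd⟩ := h id h𝒰 j hl.mem a hl.tendsto_y
  refine ⟨δ / 2, half_pos hδ, fun ε' hε' j' a' b' hl' => ?_⟩
  have hijw : Tendsto (fun k => i k (j k w)) 𝒰 (𝓝 c) := hc.tendsto hl.tendsto_w hl.ne.symm
  have hR : ∀ᶠ k in 𝒰, ε' ≤ dist (i k (j k w)) (i k (j k (y k))) := by
    filter_upwards [hd, hijw.eventually (Metric.ball_mem_nhds c (half_pos hδ))] with k h1 h2
    have := dist_triangle_left c (i k (j k (y k))) (i k (j k w))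
    simp only [id] at h1 h2
    linarith
  have hno : ∀ c', ConvAlong 𝒰 (fun k => i k * (j' k * (j k)⁻¹)⁻¹) c' a' → False :=
    fun c' hc' => ShadowMinimal.no_return hl'.pos hl'.minimal hl'.tendsto_w hl'.le_dist
      hl'.mem_limitSet (Eventually.of_forall fun k => J.mul_mem (hi k)
        (J.inv_mem (J.mul_mem (hl'.mem k) (J.inv_mem (hl.mem k))))) hc' (by simpa using hR)
  have hty : Tendsto (fun k => (j' k * (j k)⁻¹) (j k (y k))) 𝒰 (𝓝 a') := by
    simpa using hl'.tendsto_y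
  obtain ⟨t, -, ht⟩ | h1 | h1 := const_or_convAlong_of_tendsto hJ 𝒰
    (t := fun k => j' k * (j k)⁻¹)
    (Eventually.of_forall fun k => J.mul_mem (hl'.mem k) (J.inv_mem (hl.mem k)))
    hl.tendsto_w hl.tendsto_y hl.ne (by simpa using hl'.tendsto_w) hty hl'.ne
  · have hta : t a = a' := tendsto_nhds_unique
      ((t.continuous.tendsto a).comp hl.tendsto_y) (hty.congr' (ht.mono fun k hk => by
        simp only [Function.comp_apply, ← hk]))
    refine (hno c ?_).elim
    have := hc.mul_const t⁻¹
    rw [inv_inv, hta] at this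
    exact this.congr (ht.mono fun k hk => by simp only [← hk])
  · exact h1
  · exact (hno c (hc.mul h1.inv hl.ne.symm)).elim

theorem exists_level_seq (hJ : IsDiscreteConvGroup J) (h𝒰 : (𝒰 : Filter ℕ) ≤ atTop)
    (hy : ∀ k, y k ∉ limitSet J) (h : Separates J 𝒰 y) :
    ∃ (w : X) (ε : ℕ → ℝ) (j : ℕ → ℕ → X ≃ₜ X) (a b : ℕ → X),
      (∀ m, IsLevel J 𝒰 y w (ε m) (j m) (a m) (b m)) ∧ (∀ δ > 0, ∃ m, ε m < δ) ∧
      ∀ m r, m < r → ConvAlong 𝒰 (fun k => j r k * (j m k)⁻¹) (b r) (a m) := by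
  obtain ⟨w, ε₀, hε₀, hlev⟩ := exists_isLevel hJ h𝒰 hy h
  choose! j a b hl using hlev
  have hnext : ∀ ε, ∃ ε₁ > 0, 0 < ε → ε ≤ ε₀ → ∀ ε' ≤ ε₁, ∀ j' a' b',
      IsLevel J 𝒰 y w ε' j' a' b' →
      ConvAlong 𝒰 (fun k => j' k * (j ε k)⁻¹) b' (a ε) := by
    intro ε
    by_cases hε : 0 < ε ∧ ε ≤ ε₀
    · obtain ⟨ε₁, h1, h2⟩ := (hl ε hε.1 hε.2).exists_next hJ h𝒰 h
      exact ⟨ε₁, h1, fun _ _ => h2⟩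
    · exact ⟨1, one_pos, fun h1 h2 => absurd ⟨h1, h2⟩ hε⟩
  choose e he hnext using hnext
  let E : ℕ → ℝ := fun m => Nat.rec ε₀ (fun _ x => min (e x) (x / 2)) m
  have hE : ∀ m, E (m + 1) = min (e (E m)) (E m / 2) := fun _ => rfl
  have hpos : ∀ m, 0 < E m := by
    intro m
    induction m with
    | zero => exact hε₀
    | succ m ih =>
      rw [hE]
      exact lt_min (he _) (half_pos ih)
  have hanti : Antitone E := antitone_nat_of_succ_le fun m => by
    rw [hE]
    exact (min_le_right _ _).trans (half_le_self (hpos m).le)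
  have hle : ∀ m, E m ≤ ε₀ := fun m => hanti (Nat.zero_le m)
  have hpow : ∀ m, E m ≤ ε₀ * (1 / 2) ^ m := by
    intro m
    induction m with
    | zero => simp [E]
    | succ m ih =>
      rw [hE, pow_succ]
      refine (min_le_right _ _).trans ?_
      linarith
  refine ⟨w, E, fun m => j (E m), fun m => a (E m), fun m => b (E m),
    fun m => hl _ (hpos m) (hle m), fun δ hδ => ?_, fun m r hmr => ?_⟩
  · obtain ⟨m, hm⟩ := exists_pow_lt_of_lt_one (div_pos hδ hε₀) (one_half_lt_one (α := ℝ))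
    refine ⟨m, (hpow m).trans_lt ?_⟩
    rw [lt_div_iff₀ hε₀] at hm
    linarith
  · exact hnext _ (hpos m) (hle m) _
      ((hanti (Nat.succ_le_of_lt hmr)).trans ((hE m).trans_le (min_le_left _ _))) _ _ _
      (hl _ (hpos r) (hle r))

theorem IsLevel.eventually_noBad (hJ : IsDiscreteConvGroup J)
    (hl : IsLevel J 𝒰 y w ε j a b) (hl' : IsLevel J 𝒰 y w ε' j' a' b')
    (ht : ConvAlong 𝒰 (fun k => j' k * (j k)⁻¹) b' a) {R : ℝ} (hR : 0 < R) :
    ∀ᶠ p : ℕ × X × X in (𝒰 : Filter ℕ) ×ˢ (𝓝 b' ×ˢ 𝓝 a'), ∀ g ∈ J, ∀ v, R ≤ dist v b' →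
      dist (g p.2.1) (g v) < 2 * ε → 4 * ε ≤ dist (g p.2.1) (g p.2.2) →
      dist (g p.2.1) (g (j' p.1 (y p.1))) < 2 * ε := by
  by_contra hcon
  rw [not_eventually, frequently_iff_neBot] at hcon
  obtain ⟨𝒱, h𝒱⟩ := exists_ultrafilter_le (h := hcon)
  have hle := h𝒱.trans inf_le_left
  have hbad := le_principal_iff.1 (h𝒱.trans inf_le_right)
  have hbad' : ∀ᶠ p in (𝒱 : Filter (ℕ × X × X)), ∃ gv : (X ≃ₜ X) × X, gv.1 ∈ J ∧
      R ≤ dist gv.2 b' ∧ dist (gv.1 p.2.1) (gv.1 gv.2) < 2 * ε ∧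
      4 * ε ≤ dist (gv.1 p.2.1) (gv.1 p.2.2) ∧
      2 * ε ≤ dist (gv.1 p.2.1) (gv.1 (j' p.1 (y p.1))) := by
    filter_upwards [hbad] with p hp
    push Not at hp
    obtain ⟨g, hg, v, h1, h2, h3, h4⟩ := hp
    exact ⟨(g, v), hg, h1, h2, h3, h4⟩
  obtain ⟨gv, hgv⟩ := hbad'.choice
  have h1 : Tendsto (fun p : ℕ × X × X => p.1) 𝒱 𝒰 := tendsto_fst.mono_left hle
  have h2 : Tendsto (fun p : ℕ × X × X => p.2.1) 𝒱 (𝓝 b') :=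
    (tendsto_fst.comp tendsto_snd).mono_left hle
  have h3 : Tendsto (fun p : ℕ × X × X => p.2.2) 𝒱 (𝓝 a') :=
    (tendsto_snd.comp tendsto_snd).mono_left hle
  have hno : ∀ c, Tendsto (fun p => (gv p).1 p.2.1) 𝒱 (𝓝 c) →
      Tendsto (fun p => (gv p).1 (j' p.1 w)) 𝒱 (𝓝 c) →
      ConvAlong 𝒱 (fun p => (gv p).1 * (j' p.1 * (j p.1)⁻¹)) c a → False := by
    intro c hc1 hc2 hc
    refine ShadowMinimal.no_return (l := (𝒱 : Filter _)) (y := fun p : ℕ × X × X => y p.1)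
      (j := fun p : ℕ × X × X => j p.1) hl.pos (h1.eventually hl.minimal) (hl.tendsto_w.comp h1)
      hl.le_dist hl.mem_limitSet ?_ hc ?_
    · filter_upwards [hgv] with p hp
      exact J.mul_mem hp.1 (J.mul_mem (hl'.mem _) (J.inv_mem (hl.mem _)))
    · filter_upwards [hgv, eventually_dist_lt hc1 hc2 hl.pos] with p hp hp'
      have := dist_triangle ((gv p).1 p.2.1) ((gv p).1 (j' p.1 w)) ((gv p).1 (j' p.1 (y p.1)))
      simp only [mul_app, inv_app_self]
      linarith [hp.2.2.2.2]
  have hw := hl'.tendsto_w.comp h1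
  obtain ⟨g, -, hg⟩ | ⟨c, s, hc⟩ := hJ.const_or_convAlong 𝒱 (fun p => (gv p).1)
    (hgv.mono fun p hp => hp.1)
  · refine hno (g b') ?_ ?_ ?_
    · exact ((g.continuous.tendsto b').comp h2).congr' (hg.mono fun p hp => by simp [hp])
    · exact ((g.continuous.tendsto b').comp hw).congr' (hg.mono fun p hp => by simp [hp])
    · exact ((ht.comp h1).const_mul g).congr (hg.mono fun p hp => by simp [hp])
  · by_cases hs : b' = s
    · subst hs
      obtain ⟨v, hv⟩ := exists_tendsto 𝒱 fun p => (gv p).2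
      have hvb : v ≠ b' := by
        rintro rfl
        have := ge_of_tendsto (hv.dist tendsto_const_nhds) (hgv.mono fun p hp => hp.2.1)
        rw [dist_self] at this
        linarith
      obtain ⟨p, hp, hp'⟩ := (hgv.and (eventually_dist_lt (hc.tendsto hv hvb)
        (hc.tendsto h3 hl'.ne) hl.pos)).exists
      have := dist_triangle ((gv p).1 p.2.1) ((gv p).1 (gv p).2) ((gv p).1 p.2.2)
      linarith [hp.2.2.1, hp.2.2.2.1, hl.pos]
    · exact hno c (hc.tendsto h2 hs) (hc.tendsto hw hs) (hc.mul (ht.comp h1) hs)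

end Levels

section NotSeparates

variable {X : Type*} [MetricSpace X] [CompactSpace X] [Infinite X] {J : Subgroup (X ≃ₜ X)}
  {𝒰 : Ultrafilter ℕ} {y : ℕ → X}

theorem not_separates (hJ : IsDiscreteConvGroup J) (h𝒰 : (𝒰 : Filter ℕ) ≤ atTop)
    (hy : ∀ k, y k ∉ limitSet J) : ¬Separates J 𝒰 y := by
  intro h
  obtain ⟨w, ε, j, a, b, hl, hε, ht⟩ := exists_level_seq hJ h𝒰 hy h
  have hpos : ∀ r, 0 < ε r := fun r => (hl r).pos
  -- scales around the limit points
  have hρ : ∀ r, ∃ ρ > 0, ρ ≤ ε r / 4 ∧ ∀ᶠ k in 𝒰, ∀ b' ∈ Metric.ball (b r) ρ,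
      ∀ z ∈ Metric.ball (a r) ρ, ∀ m < r, ∀ g ∈ J, ∀ v, ε r / 4 ≤ dist v (b r) →
      dist (g b') (g v) < 2 * ε m → 4 * ε m ≤ dist (g b') (g z) →
      dist (g b') (g (j r k (y k))) < 2 * ε m := by
    intro r
    have h1 : ∀ᶠ p : ℕ × X × X in (𝒰 : Filter ℕ) ×ˢ (𝓝 (b r) ×ˢ 𝓝 (a r)),
        ∀ m ∈ Finset.range r, ∀ g ∈ J, ∀ v, ε r / 4 ≤ dist v (b r) →
        dist (g p.2.1) (g v) < 2 * ε m → 4 * ε m ≤ dist (g p.2.1) (g p.2.2) →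
        dist (g p.2.1) (g (j r p.1 (y p.1))) < 2 * ε m :=
      (Finset.eventually_all _).2 fun m hm => (hl m).eventually_noBad hJ (hl r)
        (ht m r (Finset.mem_range.1 hm)) (by linarith [hpos r])
    obtain ⟨A, hA, B, hB, hAB⟩ := eventually_prod_iff.1 h1
    obtain ⟨S, hS, T, hT, hST⟩ := eventually_prod_iff.1 hB
    obtain ⟨ρ₁, hρ₁, h2⟩ := Metric.mem_nhds_iff.1 hS
    obtain ⟨ρ₂, hρ₂, h3⟩ := Metric.mem_nhds_iff.1 hT
    refine ⟨min (ε r / 4) (min ρ₁ ρ₂), lt_min (by linarith [hpos r]) (lt_min hρ₁ hρ₂),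
      min_le_left _ _, hA.mono fun k hk b' hb' z hz m hm => ?_⟩
    exact hAB hk (hST (h2 (Metric.ball_subset_ball ((min_le_right _ _).trans (min_le_left _ _))
      hb')) (h3 (Metric.ball_subset_ball ((min_le_right _ _).trans (min_le_right _ _)) hz)))
      m (Finset.mem_range.2 hm)
  choose ρ hρ hρε hbad using hρ
  have hk : ∀ r, ∃ k, r ≤ k ∧
      (∀ u, u ∉ Metric.ball (a r) (ρ r) →
        (j (r + 1) k * (j r k)⁻¹) u ∈ Metric.ball (b (r + 1)) (ρ (r + 1))) ∧
      (∀ b' ∈ Metric.ball (b r) (ρ r),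
        ∀ z ∈ Metric.ball (a r) (ρ r), ∀ m < r, ∀ g ∈ J, ∀ v, ε r / 4 ≤ dist v (b r) →
        dist (g b') (g v) < 2 * ε m → 4 * ε m ≤ dist (g b') (g z) →
        dist (g b') (g (j r k (y k))) < 2 * ε m) ∧
      j r k (y k) ∈ Metric.ball (a r) (ρ r) ∧
      j (r + 1) k (y k) ∈ Metric.ball (a (r + 1)) (ρ (r + 1)) := fun r =>
    (((eventually_ge_atTop r).filter_mono h𝒰).and <|
      (ht r (r + 1) r.lt_succ_self _ (Metric.ball_mem_nhds _ (hρ _)) _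
        (Metric.ball_mem_nhds _ (hρ _))).and <|
      (hbad r).and <|
      ((hl r).tendsto_y.eventually (Metric.ball_mem_nhds _ (hρ _))).and <|
      (hl (r + 1)).tendsto_y.eventually (Metric.ball_mem_nhds _ (hρ _))).exists
  choose k hkr hstep hbad' hya hya' using hk
  have hab : ∀ r u, u ∈ Metric.ball (a r) (ρ r) → ε r / 4 ≤ dist u (b r) := by
    intro r u hu
    have := dist_triangle_left (a r) (b r) u
    rw [Metric.mem_ball] at hu
    linarith [hρε r, (hl r).le_dist, hpos r]
  have hdisj : ∀ r u, u ∈ Metric.ball (a r) (ρ r) → u ∉ Metric.ball (b r) (ρ r) := by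
    intro r u hu hu'
    have := hab r u hu
    rw [Metric.mem_ball] at hu'
    linarith [hρε r]
  -- the composed transition maps
  let Φ : ℕ → X ≃ₜ X := fun s =>
    Nat.rec 1 (fun s f => j (s + 1) (k s) * (j s (k s))⁻¹ * f) s
  have hΦ : ∀ s, Φ (s + 1) = j (s + 1) (k s) * (j s (k s))⁻¹ * Φ s := fun _ => rfl
  have hΦJ : ∀ s, Φ s ∈ J := by
    intro s
    induction s with
    | zero => exact J.one_mem
    | succ s ih =>
      rw [hΦ]
      exact J.mul_mem (J.mul_mem ((hl _).mem _) (J.inv_mem ((hl _).mem _))) ih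
  have hΦb : ∀ s, Φ s (b 0) ∈ Metric.ball (b s) (ρ s) := by
    intro s
    induction s with
    | zero => exact Metric.mem_ball_self (hρ 0)
    | succ s ih =>
      rw [hΦ, mul_app]
      exact hstep s _ fun ha => hdisj s _ ha ih
  let Y : ℕ → X := fun r => (Φ r)⁻¹ (j r (k r) (y (k r)))
  have hΦY : ∀ r s, s ≤ r → Φ s (Y r) ∈ Metric.ball (a s) (ρ s) := by
    intro r s hs
    induction hs using Nat.decreasingInduction with
    | self => simpa [Y] using hya r
    | of_succ s _ ih =>
      by_contra hcon
      refine hdisj _ _ ih ?_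
      rw [hΦ, mul_app]
      exact hstep s _ hcon
  obtain ⟨ζ, hζ⟩ := exists_tendsto 𝒰 Y
  have hζb : b 0 ≠ ζ := by
    rintro rfl
    have h1 : ∀ r, dist (Y r) (a 0) ≤ ρ 0 := fun r => (hΦY r 0 (Nat.zero_le r)).le
    have h2 := le_of_tendsto (hζ.dist (tendsto_const_nhds (x := a 0))) (Eventually.of_forall h1)
    rw [dist_comm] at h2
    linarith [hρε 0, (hl 0).le_dist, hpos 0]
  obtain ⟨ε', hε', i, hiJ, c, hc, hi⟩ := h k
    (tendsto_atTop_mono hkr (tendsto_id.mono_left h𝒰)) (fun r => (Φ r)⁻¹ * j r (k r))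
    (fun r => J.mul_mem (J.inv_mem (hΦJ r)) ((hl r).mem _)) ζ hζ
  have hib := hc.tendsto_const hζb
  obtain ⟨m, hm⟩ := hε (ε' / 8) (by positivity)
  obtain ⟨v', hv'ζ, hv'⟩ : ∃ v', v' ≠ ζ ∧
      Φ (m + 1) v' ∈ Metric.ball (a (m + 1)) (ρ (m + 1)) := by
    by_cases hcase : (Φ (m + 1))⁻¹ (a (m + 1)) = ζ
    · obtain ⟨u, hu, hua⟩ := exists_ne_of_mem_limitSet (hl (m + 1)).mem_limitSet
        (Metric.ball_mem_nhds _ (hρ (m + 1)))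
      refine ⟨(Φ (m + 1))⁻¹ u, fun e => hua ?_, by simpa using hu⟩
      exact (Φ (m + 1))⁻¹.injective (e.trans hcase.symm)
    · exact ⟨_, hcase, by simpa using hρ _⟩
  obtain ⟨r, h1, h2, h3, h4⟩ := (hi.and <| ((eventually_ge_atTop (m + 1)).filter_mono h𝒰).and <|
    (eventually_dist_lt hib (hc.tendsto_const hv'ζ) (ε := 2 * ε m) (by linarith [hpos m])).and <|
    hib.eventually (Metric.ball_mem_nhds c (half_pos hε'))).exists
  have h5 : 4 * ε m ≤ dist (i r (b 0)) (i r (Y r)) := by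
    have := dist_triangle_left c (i r (Y r)) (i r (b 0))
    change ε' ≤ dist c (i r (Y r)) at h1
    linarith
  let P : ℕ → Prop := fun s => m + 1 ≤ s ∧ ∃ v, ε s / 4 ≤ dist (Φ s v) (b s) ∧
    dist (i r (b 0)) (i r v) < 2 * ε m
  classical
  have hP : P (m + 1) := ⟨le_rfl, v', hab _ _ hv', h3⟩
  obtain ⟨hms, v, hv, hvd⟩ : P (Nat.findGreatest P r) := Nat.findGreatest_spec h2 hP
  have hsr : Nat.findGreatest P r ≤ r := Nat.findGreatest_le r
  have hmax : Nat.findGreatest P r < r → ¬P (Nat.findGreatest P r + 1) := fun hlt =>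
    Nat.findGreatest_is_greatest (Nat.lt_succ_self _) hlt
  generalize Nat.findGreatest P r = s at hms hv hsr hmax
  have h6 := hbad' s (Φ s (b 0)) (hΦb s) (Φ s (Y r)) (hΦY r s hsr) m hms (i r * (Φ s)⁻¹)
    (J.mul_mem (hiJ r) (J.inv_mem (hΦJ s))) (Φ s v) hv
  simp only [mul_app, inv_app_self] at h6
  have h7 := h6 hvd h5
  rcases hsr.eq_or_lt with rfl | hlt
  · change dist _ (i s (Y s)) < _ at h7
    linarith [hpos m]
  · refine hmax hlt ⟨by omega, (Φ s)⁻¹ (j s (k s) (y (k s))), ?_, h7⟩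
    simpa [hΦ] using hab _ _ (hya' s)

end NotSeparates

section Parabolic

variable {ι X : Type*} [MetricSpace X] [CompactSpace X] [Infinite X] {H : Subgroup (X ≃ₜ X)}

/-- Attracting maps with nearby repelling point have a fixed point near the attracting point. -/
theorem false_of_unique_fixedPt (hH : IsDiscreteConvGroup H) {l : Filter ι} [NeBot l]
    {q : ι → X ≃ₜ X} (hqH : ∀ᶠ r in l, q r ∈ H) {c α : X} (hq : ConvAlong l q c α)
    (hcα : α ≠ c) {β : ι → X} (hβ : Tendsto β l (𝓝 α))
    (hfix : ∀ᶠ r in l, ∀ z, q r z = z → z = β r) : False := by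
  obtain ⟨u, hu⟩ := (Set.toFinite {α, c}).infinite_compl.nonempty
  simp only [mem_compl_iff, mem_singleton_iff, mem_insert_iff, not_or] at hu
  obtain ⟨ρ, hρ, hρ1, hρ2, hρ3⟩ : ∃ ρ > 0, ρ ≤ dist u α ∧ ρ ≤ dist u c ∧ 2 * ρ ≤ dist c α := by
    have h1 := dist_pos.2 hu.1
    have h2 := dist_pos.2 hu.2
    have h3 := dist_pos.2 hcα.symm
    exact ⟨min (dist u α) (min (dist u c) (dist c α / 2)), by positivity, min_le_left _ _,
      (min_le_right _ _).trans (min_le_left _ _), by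
        linarith [(min_le_right (dist u α) (min (dist u c) (dist c α / 2))).trans
          (min_le_right _ _)]⟩
  obtain ⟨r, h1, h2, h3, h4⟩ := (hqH.and <| hfix.and <|
    (hβ.eventually (Metric.ball_mem_nhds α hρ)).and (hq.eventually_dist hρ)).exists
  generalize q r = f at *
  have hV : ∀ z, ρ ≤ dist z α → ρ ≤ dist (f z) α := by
    intro z hz
    have := dist_triangle_left c α (f z)
    linarith [h4 z hz]
  have hVn : ∀ n : ℕ, ∀ z, ρ ≤ dist z α → ρ ≤ dist ((f ^ n) z) α := by
    intro n
    induction n with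
    | zero => exact fun z hz => hz
    | succ n ih =>
      intro z hz
      rw [pow_succ, mul_app]
      exact ih _ (hV z hz)
  have hinj : Function.Injective fun n : ℕ => (f ^ n) u := by
    intro m n hmn
    by_contra hne
    wlog hlt : m < n generalizing m n
    · exact this hmn.symm (Ne.symm hne) (lt_of_le_of_ne (not_lt.1 hlt) (Ne.symm hne))
    obtain ⟨d, rfl⟩ := Nat.exists_eq_add_of_lt hlt
    have h5 : (f ^ m) u = (f ^ m) ((f ^ (d + 1)) u) := by
      rw [← mul_app, ← pow_add, ← add_assoc]
      exact hmn
    have h6 := (f ^ m).injective h5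
    have h7 : dist (f ((f ^ d) u)) c < ρ := h4 _ (hVn d u hρ1)
    rw [← mul_app, ← pow_succ', ← h6] at h7
    linarith
  obtain ⟨φ, hφ, c', s, hcs⟩ := hH (fun n : ℕ => f ^ n) (fun n => H.pow_mem h1 n)
    (fun m n hmn => hinj (by simp only [show f ^ m = f ^ n from hmn]))
  have hcs := isConvSeq_iff_convAlong.1 hcs
  have hns : ∀ᶠ n in atTop, (f ^ n) u ≠ s := by
    rw [← Nat.cofinite_eq_atTop]
    exact hinj.tendsto_cofinite.eventually (eventually_cofinite_ne s)
  obtain ⟨n, hn, hn'⟩ := (hns.and ((tendsto_add_atTop_nat 1).eventually hns)).exists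
  rw [pow_succ', mul_app] at hn'
  have ht := hcs.tendsto_const hn
  have ht' := hcs.tendsto_const hn'
  have hfc : f c' = c' := by
    refine tendsto_nhds_unique ((f.continuous.tendsto c').comp ht) (ht'.congr fun k => ?_)
    change (f ^ φ k * f) _ = (f * f ^ φ k) _
    rw [← pow_succ, ← pow_succ']
  have hc'V : ρ ≤ dist c' α :=
    ge_of_tendsto' (ht.dist tendsto_const_nhds) fun k => hVn _ _ (hVn n u hρ1)
  rw [h2 c' hfc] at hc'V
  exact absurd h3 (not_lt.2 hc'V)

/-- The fixed point of a parabolic element is not a conical limit point. -/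
theorem eq_of_convAlong_parabolic (hH : IsDiscreteConvGroup H) {f : X ≃ₜ X} (hf : f ∈ H) {p : X}
    (hp : ∀ z, f z = z ↔ z = p) (𝒱 : Ultrafilter ι) {g : ι → X ≃ₜ X} (hg : ∀ᶠ r in 𝒱, g r ∈ H)
    {c α : X} (hc : ConvAlong 𝒱 g c p) (hα : Tendsto (fun r => g r p) 𝒱 (𝓝 α)) : α = c := by
  by_contra hne
  have hfix : ∀ r z, (g r * f * (g r)⁻¹) z = z → z = g r p := by
    intro r z hz
    have h1 : f ((g r)⁻¹ z) = (g r)⁻¹ z := by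
      apply (g r).injective
      simpa using hz
    rw [hp] at h1
    rw [← h1, app_inv_self]
  have hqH : ∀ᶠ r in 𝒱, g r * f * (g r)⁻¹ ∈ H :=
    hg.mono fun r hr => H.mul_mem (H.mul_mem hr hf) (H.inv_mem hr)
  obtain ⟨z, hz⟩ := (Set.finite_singleton p).infinite_compl.nonempty
  simp only [mem_compl_iff, mem_singleton_iff] at hz
  have hfz : f z ≠ p := fun e => hz (f.injective (e.trans ((hp p).2 rfl).symm))
  have hgz := hc.tendsto_const hz
  have hgz' : Tendsto (fun r => (g r * f * (g r)⁻¹) (g r z)) 𝒱 (𝓝 c) := by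
    simpa using hc.tendsto_const hfz
  have hgp : Tendsto (fun r => (g r * f * (g r)⁻¹) (g r p)) 𝒱 (𝓝 α) := by
    simpa [(hp p).2 rfl] using hα
  obtain ⟨h, -, hh⟩ | ⟨c', s, hq⟩ := hH.const_or_convAlong 𝒱 (fun r => g r * f * (g r)⁻¹) hqH
  · have h1 : h α = α := tendsto_nhds_unique ((h.continuous.tendsto α).comp hα)
      (hgp.congr' (hh.mono fun r hr => by rw [hr]; rfl))
    have h2 : h c = c := tendsto_nhds_unique ((h.continuous.tendsto c).comp hgz)
      (hgz'.congr' (hh.mono fun r hr => by rw [hr]; rfl))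
    obtain ⟨r, hr⟩ := hh.exists
    rw [← hr] at h1 h2
    exact hne ((hfix r _ h1).trans (hfix r _ h2).symm)
  · by_cases hsα : α = s
    · subst hsα
      have := tendsto_nhds_unique hgz' (hq.tendsto hgz (Ne.symm hne))
      subst this
      exact false_of_unique_fixedPt hH hqH hq hne hα (Eventually.of_forall hfix)
    · have h1 := tendsto_nhds_unique hgp (hq.tendsto hα hsα)
      subst h1
      by_cases hsc : c = s
      · subst hsc
        refine false_of_unique_fixedPt hH (hqH.mono fun r hr => H.inv_mem hr) hq.inv hne hα
          (Eventually.of_forall fun r z hz => hfix r z ?_)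
        conv_lhs => rw [← hz]
        exact app_inv_self _ _
      · exact hne (tendsto_nhds_unique hgz' (hq.tendsto hgz hsc)).symm

end Parabolic

section Cosets

theorem false_of_three_ne {α : Type*} {p q r e ω : α} (hqp : q ≠ p) (hrq : r ≠ q) (hrp : r ≠ p)
    (hp : p ≠ e → p = ω) (hq : q ≠ e → q = ω) (hr : r ≠ e → r = ω) : False := by
  by_cases h1 : p = e <;> by_cases h2 : q = e <;> by_cases h3 : r = e <;> simp_all

variable {X : Type*} [MetricSpace X] [CompactSpace X] [Infinite X] {H J : Subgroup (X ≃ₜ X)}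

theorem exists_diagonal {l : Filter ℕ} (hl : l ≤ atTop) {P : ℕ → ℕ → Prop}
    (hP : ∀ n, ∀ᶠ r in l, P n r) : ∃ ν : ℕ → ℕ, Tendsto ν l atTop ∧ ∀ᶠ r in l, P (ν r) r := by
  classical
  refine ⟨fun r => Nat.findGreatest (fun n => P n r) r, tendsto_atTop.2 fun n => ?_, ?_⟩
  · filter_upwards [hP n, (eventually_ge_atTop n).filter_mono hl] with r hr hn
    exact Nat.le_findGreatest hn hr
  · filter_upwards [hP 0] with r hr
    exact Nat.findGreatest_spec (P := fun n => P n r) (Nat.zero_le r) hr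

theorem IsConicalLimitPt.exists_convAlong (hH : IsDiscreteConvGroup H) {p : X}
    (hp : IsConicalLimitPt H p) : ∃ f : ℕ → X ≃ₜ X, (∀ n, f n ∈ H) ∧ ∃ c, ∃ δ > 0,
      ConvAlong atTop f c p ∧ ∀ n, δ ≤ dist c (f n p) := by
  obtain ⟨g, hg, hinj, hK⟩ := hp
  obtain ⟨φ, hφ, c, s, hcs⟩ := hH g hg hinj
  have hcs := isConvSeq_iff_convAlong.1 hcs
  have hsep : ∀ z, z ≠ p → ∃ δ > 0, ∀ k, δ ≤ dist (g k p) (g k z) := by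
    intro z hz
    obtain ⟨K, hKc, hKd, hKg⟩ := hK z hz
    obtain ⟨q, hq, hmin⟩ := hKc.exists_isMinOn ⟨_, hKg 0⟩
      (continuous_dist (α := X)).continuousOn
    exact ⟨dist q.1 q.2, dist_pos.2 (hKd q hq), fun k => hmin (hKg k)⟩
  have hsp : p = s := by
    by_contra hne
    obtain ⟨z, hz⟩ := (Set.toFinite {p, s}).infinite_compl.nonempty
    simp only [mem_compl_iff, mem_singleton_iff, mem_insert_iff, not_or] at hz
    obtain ⟨δ, hδ, h⟩ := hsep z hz.1
    obtain ⟨k, hk⟩ := (eventually_dist_lt (hcs.tendsto_const hne)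
      (hcs.tendsto_const hz.2) hδ).exists
    exact absurd (h (φ k)) (not_le.2 hk)
  subst hsp
  obtain ⟨z, hz⟩ := (Set.finite_singleton p).infinite_compl.nonempty
  simp only [mem_compl_iff, mem_singleton_iff] at hz
  obtain ⟨δ, hδ, h⟩ := hsep z hz
  obtain ⟨N, hN⟩ := eventually_atTop.1
    ((hcs.tendsto_const hz).eventually (Metric.ball_mem_nhds c (half_pos hδ)))
  refine ⟨fun n => g (φ (n + N)), fun n => hg _, c, δ / 2, half_pos hδ,
    hcs.comp (tendsto_add_atTop_nat N), fun n => ?_⟩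
  have h1 : dist (g (φ (n + N)) z) c < δ / 2 := hN (n + N) (Nat.le_add_left _ _)
  have h2 := h (φ (n + N))
  have h3 := dist_triangle_right (g (φ (n + N)) p) (g (φ (n + N)) z) c
  rw [dist_comm c]
  linarith

/-- At a conical limit point, one may separate a convergent sequence from the attracting
point. -/
theorem IsConicalLimitPt.exists_separating (hJ : IsDiscreteConvGroup J) {p : X}
    (hp : IsConicalLimitPt J p) {l : Filter ℕ} (hl : l ≤ atTop) {v : ℕ → X}
    (hv : Tendsto v l (𝓝 p)) : ∃ ε > 0, ∃ i : ℕ → X ≃ₜ X, (∀ r, i r ∈ J) ∧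
      ∃ c, ConvAlong l i c p ∧ ∀ᶠ r in l, ε ≤ dist c (i r (v r)) := by
  obtain ⟨f, hf, c, δ, hδ, hc, hd⟩ := hp.exists_convAlong hJ
  obtain ⟨ν, hν, hνr⟩ := exists_diagonal hl (P := fun n r => δ / 2 ≤ dist c (f n (v r)))
    (fun n => ((tendsto_const_nhds (x := c)).dist
      (((f n).continuous.tendsto p).comp hv)).eventually_const_le
        ((half_lt_self hδ).trans_le (hd n)))
  exact ⟨δ / 2, half_pos hδ, fun r => f (ν r), fun r => hf _, c, hc.comp hν, hνr⟩

theorem not_isConicalLimitPt_of_isParabolicPt (hH : IsDiscreteConvGroup H) {p : X}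
    {f : X ≃ₜ X} (hf : f ∈ H) (hfp : ∀ z, f z = z ↔ z = p) : ¬IsConicalLimitPt H p := by
  intro hp
  obtain ⟨g, hg, c, δ, hδ, hc, hd⟩ := hp.exists_convAlong hH
  obtain ⟨α, hα⟩ := exists_tendsto (hyperfilter ℕ) fun r => g r p
  have hle : (hyperfilter ℕ : Filter ℕ) ≤ atTop := Nat.hyperfilter_le_atTop
  have h1 := eq_of_convAlong_parabolic hH hf hfp (hyperfilter ℕ) (Eventually.of_forall hg)
    (hc.mono hle) hα
  subst h1
  have h2 := ge_of_tendsto' ((tendsto_const_nhds (x := α)).dist hα) hd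
  rw [dist_self] at h2
  linarith

/-- The ping-pong data for a group `H` relative to its subgroup `J`. -/
structure PingPongSets (H J : Subgroup (X ≃ₜ X)) (C O : Set X) : Prop where
  isClosed : IsClosed C
  disjoint : Disjoint C O
  le : J ≤ H
  exists_notMem : ∃ h ∈ H, h ∉ J
  inv : ∀ j ∈ J, ∀ z ∈ C, j z ∈ C
  limitSet_diff_subset : limitSet H \ limitSet J ⊆ O
  limitSet_subset : limitSet J ⊆ C
  maps : ∀ g ∈ H, g ∉ J → ∀ z ∈ C, g z ∈ O

variable {C O : Set X}

theorem PingPongSets.separates (h : PingPongSets H J C O) (hH : IsDiscreteConvGroup H)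
    (hHgf : IsGeomFinite H) (hJgf : IsGeomFinite J) {𝒰 : Ultrafilter ℕ}
    (h𝒰 : (𝒰 : Filter ℕ) ≤ atTop) {a : ℕ → X ≃ₜ X} (ha : ∀ k, a k ∈ H)
    (hdist : ∀ k l, k < l → (a k)⁻¹ * a l ∉ J) {y : ℕ → X} (hy : ∀ k, y k ∈ C) {x : X}
    (hx : Tendsto (fun k => a k (y k)) atTop (𝓝 x)) (hxH : x ∉ limitSet H) :
    Separates J 𝒰 y := by
  intro κ hκ β hβ p hp
  have hJ : IsDiscreteConvGroup J := hH.mono h.le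
  let b : ℕ → X ≃ₜ X := fun r => a (κ r) * (β r)⁻¹
  have hbH : ∀ r, b r ∈ H := fun r => H.mul_mem (ha _) (h.le (J.inv_mem (hβ r)))
  have hbx : Tendsto (fun r => b r (β r (y (κ r)))) 𝒰 (𝓝 x) := by
    simpa [b, Function.comp_def] using hx.comp hκ
  obtain ⟨e, s, hb⟩ : ∃ e s, ConvAlong 𝒰 b e s := by
    obtain ⟨g, -, hg⟩ | hb := hH.const_or_convAlong 𝒰 b (Eventually.of_forall hbH)
    · exfalso
      obtain ⟨r, hr⟩ := hg.exists
      obtain ⟨r', hr', hlt⟩ := (hg.and (hκ.eventually_gt_atTop (κ r))).exists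
      have h1 : (a (κ r))⁻¹ * a (κ r') = (β r)⁻¹ * β r' := by
        have h2 : a (κ r) = g * β r := by rw [← hr]; simp [b]
        have h3 : a (κ r') = g * β r' := by rw [← hr']; simp [b]
        rw [h2, h3]
        group
      refine hdist _ _ hlt ?_
      rw [h1]
      exact J.mul_mem (J.inv_mem (hβ r)) (hβ r')
    · exact hb
  have heH : e ∈ limitSet H := mem_limitSet_of_convAlong (Eventually.of_forall hbH) hb
  have hps : p = s := by
    by_contra hne
    exact hxH (tendsto_nhds_unique hbx (hb.tendsto hp hne) ▸ heH)
  subst hps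
  have hpH : p ∈ limitSet H := mem_limitSet_of_convAlong_inv (Eventually.of_forall hbH) hb
  have hpC : p ∈ C := h.isClosed.mem_of_tendsto hp
    (Eventually.of_forall fun r => h.inv _ (hβ r) _ (hy _))
  have hpJ : p ∈ limitSet J := by
    by_contra hpJ
    exact disjoint_left.1 h.disjoint hpC (h.limitSet_diff_subset ⟨hpH, hpJ⟩)
  obtain hcon | ⟨⟨f, hfJ, ⟨-, hf⟩, hfp⟩, -⟩ := hJgf p hpJ
  · exact hcon.exists_separating hJ h𝒰 hp
  have hfix : ∀ z, f z = z ↔ z = p := fun z =>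
    ⟨fun hz => hf.unique hz hfp, fun hz => hz ▸ hfp⟩
  have hpno : ∀ (g : ℕ → X ≃ₜ X) (c α : X), (∀ r, g r ∈ H) → ConvAlong 𝒰 g c p →
      Tendsto (fun r => g r p) 𝒰 (𝓝 α) → α = c := fun g c α hg hc hα =>
    eq_of_convAlong_parabolic hH (h.le hfJ) hfix 𝒰 (Eventually.of_forall hg) hc hα
  obtain hcon | ⟨-, K, hK, hKsub, hKcov⟩ := hHgf p hpH
  · exact absurd hcon (not_isConicalLimitPt_of_isParabolicPt hH (h.le hfJ) hfix)
  have hstab : ∀ g ∈ H, g p = p → g ∈ J := by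
    intro g hg hgp
    by_contra hgJ
    have := h.maps g hg hgJ p hpC
    rw [hgp] at this
    exact disjoint_left.1 h.disjoint hpC this
  obtain ⟨ω, hω⟩ := exists_tendsto 𝒰 fun r => b r p
  obtain ⟨e', he'H, he'e, he'ω⟩ : ∃ e' ∈ limitSet H, e' ≠ e ∧ e' ≠ ω := by
    obtain ⟨g, hg, hgJ⟩ := h.exists_notMem
    have hqp : g p ≠ p := fun hgp => hgJ (hstab g hg hgp)
    have hqH : g p ∈ limitSet H := app_mem_limitSet hg hpH
    have hfq : f (g p) ≠ g p := fun hq => hqp ((hfix _).1 hq)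
    have hfq' : f (g p) ≠ p := fun hq => hqp (f.injective (hq.trans hfp.symm))
    have hfqH : f (g p) ∈ limitSet H := app_mem_limitSet (h.le hfJ) hqH
    by_contra! hno
    have h1 := hno _ hpH
    have h2 := hno _ hqH
    have h3 := hno _ hfqH
    exact false_of_three_ne hqp hfq hfq' h1 h2 h3
  have hbe' : Tendsto (fun r => (b r)⁻¹ e') 𝒰 (𝓝 p) := hb.inv.tendsto_const he'e
  have hne' : ∀ᶠ r in 𝒰, (b r)⁻¹ e' ≠ p := by
    filter_upwards [hω.eventually (isOpen_compl_singleton.mem_nhds (Ne.symm he'ω))] with r hr hr'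
    exact hr (by rw [← hr', app_inv_self]; rfl)
  have hex : ∀ r, ∃ g ∈ J, g p = p ∧ ((b r)⁻¹ e' ≠ p → g ((b r)⁻¹ e') ∈ K) := by
    intro r
    by_cases hr : (b r)⁻¹ e' = p
    · exact ⟨1, J.one_mem, rfl, fun hr' => absurd hr hr'⟩
    · obtain ⟨g, hg, hgp, hgK⟩ := hKcov _ ⟨app_mem_limitSet (H.inv_mem (hbH r)) he'H, hr⟩
      exact ⟨g, hstab g hg hgp, hgp, fun _ => hgK⟩
  choose q hqJ hqp hqK using hex
  have hqK' : ∀ᶠ r in 𝒰, q r ((b r)⁻¹ e') ∈ K := hne'.mono fun r hr => hqK r hr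
  have hpK : p ∉ K := fun hpK => (hKsub hpK).2 rfl
  have hqp' : Tendsto (fun r => q r p) 𝒰 (𝓝 p) := by
    simpa only [hqp] using tendsto_const_nhds
  have hqc : ConvAlong 𝒰 q p p := by
    obtain ⟨g, -, hg⟩ | ⟨c, s, hc⟩ := hJ.const_or_convAlong 𝒰 q (Eventually.of_forall hqJ)
    · exfalso
      have hgp : g p = p := by
        obtain ⟨r, hr⟩ := hg.exists
        rw [← hr, hqp]
      have h1 : Tendsto (fun r => q r ((b r)⁻¹ e')) 𝒰 (𝓝 (g p)) :=
        ((g.continuous.tendsto p).comp hbe').congr' (hg.mono fun r hr => by simp [hr])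
      rw [hgp] at h1
      exact hpK (hK.isClosed.mem_of_tendsto h1 hqK')
    · have hps : p = s := by
        by_contra hne
        have h1 := tendsto_nhds_unique hqp' (hc.tendsto_const hne)
        subst h1
        exact hpK (hK.isClosed.mem_of_tendsto (hc.tendsto hbe' hne) hqK')
      subst hps
      rw [← hpno q c p (fun r => h.le (hqJ r)) hc hqp'] at hc
      exact hc
  obtain ⟨v, hv⟩ := exists_tendsto 𝒰 fun r => q r (β r (y (κ r)))
  have hvp : p ≠ v := by
    rintro rfl
    let d : ℕ → X ≃ₜ X := fun r => b r * (q r)⁻¹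
    have hdH : ∀ r, d r ∈ H := fun r => H.mul_mem (hbH r) (h.le (J.inv_mem (hqJ r)))
    have hdx : Tendsto (fun r => d r (q r (β r (y (κ r))))) 𝒰 (𝓝 x) := by
      simpa [d] using hbx
    have hdp : Tendsto (fun r => d r p) 𝒰 (𝓝 ω) := by
      refine hω.congr fun r => ?_
      have : (q r)⁻¹ p = p := by
        conv_lhs => rw [← hqp r]
        exact inv_app_self _ _
      simp only [d, mul_app, this]
    obtain ⟨g, hgH, hg⟩ | ⟨c, s, hc⟩ := hH.const_or_convAlong 𝒰 d (Eventually.of_forall hdH)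
    · have h1 : g p = x := tendsto_nhds_unique ((g.continuous.tendsto p).comp hv)
        (hdx.congr' (hg.mono fun r hr => by simp [hr]))
      exact hxH (h1 ▸ app_mem_limitSet hgH hpH)
    · have hcH : c ∈ limitSet H := mem_limitSet_of_convAlong (Eventually.of_forall hdH) hc
      have hps : p = s := by
        by_contra hne
        exact hxH (tendsto_nhds_unique hdx (hc.tendsto hv hne) ▸ hcH)
      subst hps
      obtain ⟨z, hz⟩ := exists_tendsto 𝒰 fun r => q r ((b r)⁻¹ e')
      have hzp : z ≠ p := by
        intro e
        rw [e] at hz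
        exact hpK (hK.isClosed.mem_of_tendsto hz hqK')
      have h2 : Tendsto (fun r => d r (q r ((b r)⁻¹ e'))) 𝒰 (𝓝 e') := by
        simp [d]
      have h3 := tendsto_nhds_unique h2 (hc.tendsto hz hzp)
      subst h3
      exact he'ω (hpno d _ ω hdH hc hdp).symm
  exact ⟨dist p v / 2, half_pos (dist_pos.2 hvp), q, hqJ, p, hqc,
    ((tendsto_const_nhds (x := p)).dist hv).eventually_const_le
      (half_lt_self (dist_pos.2 hvp))⟩

/-- Images of `C` under infinitely many cosets of `J` only accumulate at limit points of `H`. -/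
theorem PingPongSets.mem_limitSet_of_tendsto (h : PingPongSets H J C O)
    (hH : IsDiscreteConvGroup H) (hHgf : IsGeomFinite H) (hJgf : IsGeomFinite J)
    {a : ℕ → X ≃ₜ X} (ha : ∀ k, a k ∈ H) (hdist : ∀ k l, k < l → (a k)⁻¹ * a l ∉ J)
    {y : ℕ → X} (hy : ∀ k, y k ∈ C) {x : X} (hx : Tendsto (fun k => a k (y k)) atTop (𝓝 x)) :
    x ∈ limitSet H := by
  by_contra hxH
  obtain ⟨N, hN⟩ := eventually_atTop.1
    (hx.eventually (isClosed_limitSet.isOpen_compl.mem_nhds hxH))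
  refine not_separates (y := fun k => y (k + N)) (hH.mono h.le) Nat.hyperfilter_le_atTop
    (fun k hk => hN (k + N) (Nat.le_add_left _ _)
      (app_mem_limitSet (ha _) (limitSet_mono h.le hk)))
    (h.separates hH hHgf hJgf Nat.hyperfilter_le_atTop (a := fun k => a (k + N))
      (fun k => ha _) (fun k l hkl => hdist _ _ (by omega)) (fun k => hy _)
      (hx.comp (tendsto_add_atTop_nat N)) hxH)

end Cosets

section Amalgam

variable {X : Type*} [TopologicalSpace X] {Γ : Fin 2 → Subgroup (X ≃ₜ X)} {J : Subgroup (X ≃ₜ X)}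

theorem fin_two_sub_sub (i : Fin 2) : 1 - (1 - i) = i := by
  fin_cases i <;> rfl

theorem fin_two_eq_or (i k : Fin 2) : k = i ∨ k = 1 - i := by
  fin_cases i <;> fin_cases k <;> simp

/-- Reduced words in the amalgam of `Γ 0` and `Γ 1` along `J`, beginning with a letter of type
`i` and ending with a letter of type `j`. -/
inductive IsReduced (Γ : Fin 2 → Subgroup (X ≃ₜ X)) (J : Subgroup (X ≃ₜ X)) :
    Fin 2 → Fin 2 → (X ≃ₜ X) → Prop
  | single {i f} : f ∈ Γ i → f ∉ J → IsReduced Γ J i i f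
  | cons {i j a f} : a ∈ Γ i → a ∉ J → IsReduced Γ J (1 - i) j f → IsReduced Γ J i j (a * f)

theorem IsReduced.mul_left_of_mem (hle : ∀ i, J ≤ Γ i) {i j : Fin 2} {c f : X ≃ₜ X}
    (hf : IsReduced Γ J i j f) (hc : c ∈ J) : IsReduced Γ J i j (c * f) := by
  cases hf with
  | single h1 h2 =>
    exact .single ((Γ i).mul_mem (hle i hc) h1) fun h => h2 ((J.mul_mem_cancel_left hc).1 h)
  | cons h1 h2 h3 =>
    rw [← mul_assoc]
    exact .cons ((Γ i).mul_mem (hle i hc) h1) (fun h => h2 ((J.mul_mem_cancel_left hc).1 h)) h3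

theorem IsReduced.mul_left (hle : ∀ i, J ≤ Γ i) {i j k : Fin 2} {c f : X ≃ₜ X}
    (hf : IsReduced Γ J i j f) (hc : c ∈ Γ k) :
    c * f ∈ J ∨ ∃ i' j', IsReduced Γ J i' j' (c * f) := by
  by_cases hcJ : c ∈ J
  · exact Or.inr ⟨i, j, hf.mul_left_of_mem hle hcJ⟩
  obtain rfl | rfl := fin_two_eq_or i k
  · cases hf with
    | single h1 h2 =>
      by_cases h : c * f ∈ J
      · exact Or.inl h
      · exact Or.inr ⟨_, _, .single (mul_mem hc h1) h⟩
    | @cons _ _ a f' h1 h2 h3 =>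
      rw [← mul_assoc]
      by_cases h : c * a ∈ J
      · exact Or.inr ⟨_, _, h3.mul_left_of_mem hle h⟩
      · exact Or.inr ⟨_, _, .cons (mul_mem hc h1) h h3⟩
  · exact Or.inr ⟨1 - i, j, .cons hc hcJ (by rwa [fin_two_sub_sub])⟩

theorem mem_or_isReduced (hle : ∀ i, J ≤ Γ i) {f : X ≃ₜ X} (hf : f ∈ Γ 0 ⊔ Γ 1) :
    f ∈ J ∨ ∃ i j, IsReduced Γ J i j f := by
  have key : ∀ (k : Fin 2) (c : X ≃ₜ X), c ∈ Γ k → ∀ g, (g ∈ J ∨ ∃ i j, IsReduced Γ J i j g) →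
      c * g ∈ J ∨ ∃ i j, IsReduced Γ J i j (c * g) := by
    rintro k c hc g (hg | ⟨i, j, hg⟩)
    · by_cases hcg : c * g ∈ J
      · exact Or.inl hcg
      · exact Or.inr ⟨k, k, .single ((Γ k).mul_mem hc (hle k hg)) hcg⟩
    · exact hg.mul_left hle hc
  rw [Subgroup.sup_eq_closure] at hf
  induction hf using Subgroup.closure_induction_left with
  | one => exact Or.inl J.one_mem
  | mul_left c hc g _ ih =>
    rcases hc with hc | hc
    exacts [key 0 c hc g ih, key 1 c hc g ih]
  | inv_mul_cancel c hc g _ ih =>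
    rcases hc with hc | hc
    exacts [key 0 _ (inv_mem hc) g ih, key 1 _ (inv_mem hc) g ih]

end Amalgam

section PingPongFamily

variable {X : Type*} [MetricSpace X] [CompactSpace X] [Infinite X]
  {Γ : Fin 2 → Subgroup (X ≃ₜ X)} {J : Subgroup (X ≃ₜ X)} {C O : Fin 2 → Set X}

omit [CompactSpace X] [Infinite X] in
theorem IsReduced.exists_letter (h : ∀ i, PingPongSets (Γ i) J (C i) (O (1 - i)))
    (hOC : ∀ i, O i ⊆ C i) {i j : Fin 2} {f : X ≃ₜ X} (hf : IsReduced Γ J i j f) :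
    ∃ a ∈ Γ i, a ∉ J ∧ ∀ z ∈ C j, a⁻¹ (f z) ∈ C i := by
  induction hf with
  | @single i f h1 h2 => exact ⟨f, h1, h2, fun z hz => by simpa⟩
  | @cons i j a f h1 h2 _ ih =>
    obtain ⟨b, hb, hbJ, hbC⟩ := ih
    refine ⟨a, h1, h2, fun z hz => ?_⟩
    have h3 := (h _).maps b hb hbJ _ (hbC z hz)
    rw [fin_two_sub_sub, app_inv_self] at h3
    simpa using hOC _ h3

omit [CompactSpace X] [Infinite X] in
theorem IsReduced.inv_app_mem (h : ∀ i, PingPongSets (Γ i) J (C i) (O (1 - i)))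
    (hOC : ∀ i, O i ⊆ C i) {i j : Fin 2} {f : X ≃ₜ X} (hf : IsReduced Γ J i j f) :
    ∀ z ∈ C i, f⁻¹ z ∈ O (1 - j) := by
  have key : ∀ {i : Fin 2} {a : X ≃ₜ X}, a ∈ Γ i → a ∉ J → ∀ z ∈ C i, a⁻¹ z ∈ O (1 - i) :=
    fun ha haJ => (h _).maps _ (inv_mem ha) (fun h => haJ (inv_mem_iff.1 h))
  induction hf with
  | single h1 h2 => exact key h1 h2
  | cons h1 h2 _ ih =>
    intro z hz
    rw [mul_inv_rev]
    exact ih _ (hOC _ (key h1 h2 z hz))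

theorem exists_mem_open_ne {G : Subgroup (X ≃ₜ X)} {a : X} (ha : a ∈ limitSet G) {U : Set X}
    (hU : IsOpen U) (hne : U.Nonempty) : ∃ u ∈ U, u ≠ a := by
  by_cases h : a ∈ U
  · exact exists_ne_of_mem_limitSet ha (hU.mem_nhds h)
  · exact hne.imp fun u hu => ⟨hu, fun e => h (e ▸ hu)⟩

/-- A limit point of the amalgam outside the limit set of the factors lies in the image of some
`C i` under a letter of type `i`. -/
theorem exists_letter_of_mem_limitSet (h : ∀ i, PingPongSets (Γ i) J (C i) (O (1 - i)))
    (hOC : ∀ i, O i ⊆ C i) (hO : ∀ i, IsOpen (O i)) (hne : ∀ i, (O i).Nonempty)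
    (hΓ : ∀ i, IsDiscreteConvGroup (Γ i)) (hΓgf : ∀ i, IsGeomFinite (Γ i))
    (hJgf : IsGeomFinite J) {x : X} (hx : x ∈ limitSet (Γ 0 ⊔ Γ 1))
    (hxΓ : ∀ i, x ∉ limitSet (Γ i)) : ∃ i, ∃ a ∈ Γ i, a ∉ J ∧ a⁻¹ x ∈ C i := by
  obtain ⟨f, s, hfG, -, hf⟩ := exists_convAlong_of_mem hx
  obtain ⟨i, j, hij⟩ : ∃ i j, ∃ᶠ n in atTop, IsReduced Γ J i j (f n) := by
    by_contra! hno
    have h1 : ∀ᶠ n in atTop, f n ∈ J := by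
      have h2 : ∀ i j, ∀ᶠ n in atTop, ¬IsReduced Γ J i j (f n) := fun i j =>
        hno i j
      filter_upwards [eventually_all.2 fun i => eventually_all.2 (h2 i)] with n hn
      refine (mem_or_isReduced (fun i => (h i).le) (hfG n)).resolve_right ?_
      rintro ⟨i, j, hij⟩
      exact hn i j hij
    exact hxΓ 0 (limitSet_mono (h 0).le (mem_limitSet_of_convAlong h1 hf))
  obtain ⟨φ, hφ, hred⟩ := extraction_of_frequently_atTop hij
  have hf' : ConvAlong atTop (fun n => f (φ n)) x s := hf.comp hφ.tendsto_atTop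
  have hsj : s ∉ O j := by
    obtain ⟨u, hu, hux⟩ := exists_mem_open_ne hx (hO i) (hne i)
    intro hs
    obtain ⟨n, hn⟩ := ((hf'.inv.tendsto_const hux).eventually ((hO j).mem_nhds hs)).exists
    have h1 := (hred n).inv_app_mem h hOC u (hOC i hu)
    exact disjoint_left.1 (h j).disjoint (hOC j hn) h1
  obtain ⟨v, hv⟩ := hne j
  have hvs : v ≠ s := fun e => hsj (e ▸ hv)
  have hfv : Tendsto (fun n => f (φ n) v) atTop (𝓝 x) := hf'.tendsto_const hvs
  choose a ha haJ haC using fun n => (hred n).exists_letter h hOC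
  by_cases hm : ∃ m, ∃ᶠ n in atTop, (a m)⁻¹ * a n ∈ J
  · obtain ⟨m, hm⟩ := hm
    refine ⟨i, a m, ha m, haJ m, ?_⟩
    obtain ⟨ψ, hψ, hψJ⟩ := extraction_of_frequently_atTop hm
    refine (h i).isClosed.mem_of_tendsto
      ((((a m)⁻¹).continuous.tendsto x).comp (hfv.comp hψ.tendsto_atTop))
      (Eventually.of_forall fun n => ?_)
    have h1 := (h i).inv _ (hψJ n) _ (haC (ψ n) v (hOC j hv))
    simpa using h1
  · push Not at hm
    exfalso
    obtain ⟨ψ, hψ⟩ := exists_seq_of_forall_finset_exists (fun _ : ℕ => True)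
      (fun m n => m < n ∧ (a m)⁻¹ * a n ∉ J) fun s _ => by
        obtain ⟨n, hn⟩ := ((eventually_all_finset s).2 fun m _ =>
          (eventually_gt_atTop m).and (hm m)).exists
        exact ⟨n, trivial, hn⟩
    have hψm : StrictMono ψ := fun m n hmn => (hψ.2 m n hmn).1
    refine hxΓ i ((h i).mem_limitSet_of_tendsto (hΓ i) (hΓgf i) hJgf (a := fun n => a (ψ n))
      (fun n => ha _) (fun m n hmn => (hψ.2 m n hmn).2)
      (y := fun n => (a (ψ n))⁻¹ (f (φ (ψ n)) v)) (fun n => haC _ v (hOC j hv)) ?_)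
    simpa [Function.comp_def] using hfv.comp hψm.tendsto_atTop

theorem exists_coding (h : ∀ i, PingPongSets (Γ i) J (C i) (O (1 - i)))
    (hOC : ∀ i, O i ⊆ C i) (hO : ∀ i, IsOpen (O i)) (hne : ∀ i, (O i).Nonempty)
    (hΓ : ∀ i, IsDiscreteConvGroup (Γ i)) (hΓgf : ∀ i, IsGeomFinite (Γ i))
    (hJgf : IsGeomFinite J) {x : X} (hx : x ∈ limitSet (Γ 0 ⊔ Γ 1))
    (hxΓ : ∀ g ∈ Γ 0 ⊔ Γ 1, ∀ i, g x ∉ limitSet (Γ i)) :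
    ∃ (g f : ℕ → X ≃ₜ X) (i : ℕ → Fin 2), (∀ k, g k ∈ Γ (i k)) ∧ (∀ k, g k ∉ J) ∧
      (∀ k, i (k + 1) = 1 - i k) ∧ f 0 = g 0 ∧ (∀ k, f (k + 1) = f k * g (k + 1)) ∧
      ∀ k, (f k)⁻¹ x ∈ C (i k) := by
  have hle : ∀ i, Γ i ≤ Γ 0 ⊔ Γ 1 := by
    intro i
    fin_cases i
    exacts [le_sup_left, le_sup_right]
  have hstep : ∀ f : (Γ 0 ⊔ Γ 1 : Subgroup (X ≃ₜ X)), ∃ (i : Fin 2) (a : X ≃ₜ X), a ∈ Γ i ∧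
      a ∉ J ∧ a⁻¹ ((f : X ≃ₜ X)⁻¹ x) ∈ C i := by
    rintro ⟨f, hf⟩
    obtain ⟨i, a, h1, h2, h3⟩ := exists_letter_of_mem_limitSet h hOC hO hne hΓ hΓgf hJgf
      (app_mem_limitSet (inv_mem hf) hx) (hxΓ _ (inv_mem hf))
    exact ⟨i, a, h1, h2, h3⟩
  choose ι α hα hαJ hαC using hstep
  let F : ℕ → (Γ 0 ⊔ Γ 1 : Subgroup (X ≃ₜ X)) :=
    Nat.rec 1 fun _ f => f * ⟨α f, hle _ (hα f)⟩
  have hF : ∀ k, (F (k + 1)).1 = (F k).1 * α (F k) := by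
    intro k
    rfl
  have hFC : ∀ k, (F (k + 1) : X ≃ₜ X)⁻¹ x ∈ C (ι (F k)) := fun k => by
    rw [hF, mul_inv_rev]
    exact hαC (F k)
  refine ⟨fun k => α (F k), fun k => F (k + 1), fun k => ι (F k), fun k => hα _, fun k => hαJ _,
    fun k => ?_, ?_, fun k => hF (k + 1), hFC⟩
  · refine (fin_two_eq_or (ι (F k)) (ι (F (k + 1)))).resolve_left fun he => ?_
    have h1 := (h _).maps _ (hα (F (k + 1))) (hαJ _) _ (hαC (F (k + 1)))
    rw [app_inv_self, he] at h1
    exact disjoint_left.1 (h _).disjoint (hFC k) h1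
  · change (F (0 + 1) : X ≃ₜ X) = _
    rw [hF]
    exact one_mul _

end PingPongFamily

theorem pingPongSets_closure_interior {X : Type*} [MetricSpace X] [CompactSpace X] [Infinite X]
    {H J : Subgroup (X ≃ₜ X)} (hlt : J < H) {B B' : Set X}
    (hB : IsClosed B) (hne : (interior B).Nonempty) (hdisj : Disjoint (interior B) (interior B'))
    (hinv : ∀ j ∈ J, ⇑j '' B = B) (hmaps : ∀ g ∈ H, g ∉ J → ⇑g '' B ⊆ interior B')
    (hlim : limitSet H \ limitSet J ⊆ interior B') :
    PingPongSets H J (closure (interior B)) (interior B') where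
  isClosed := isClosed_closure
  disjoint := hdisj.closure_left isOpen_interior
  le := hlt.le
  exists_notMem := (SetLike.lt_iff_le_and_exists.1 hlt).2
  inv j hj z hz := by
    have h1 : j '' closure (interior B) = closure (interior B) := by
      rw [j.image_closure, j.image_interior, hinv j hj]
    exact h1 ▸ mem_image_of_mem _ hz
  limitSet_diff_subset := hlim
  limitSet_subset c hc := by
    obtain ⟨g, s, hg, -, hgc⟩ := exists_convAlong_of_mem hc
    have hs : s ∈ limitSet J := mem_limitSet_of_convAlong_inv (Eventually.of_forall hg) hgc
    obtain ⟨u, hu, hus⟩ := exists_mem_open_ne hs isOpen_interior hne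
    refine mem_closure_of_tendsto (hgc.tendsto_const hus) (Eventually.of_forall fun k => ?_)
    have h1 : g k '' interior B = interior B := by rw [(g k).image_interior, hinv _ (hg k)]
    exact h1 ▸ mem_image_of_mem _ hu
  maps g hg hgJ z hz :=
    hmaps g hg hgJ (mem_image_of_mem _ (closure_minimal interior_subset hB hz))

theorem infinite_of_mem_limitSet {X : Type*} [TopologicalSpace X] {G : Subgroup (X ≃ₜ X)} {x : X}
    (hx : x ∈ limitSet G) : Infinite X := by
  obtain ⟨g, -, hg, -⟩ := hx
  by_contra hfin
  rw [not_infinite_iff_finite] at hfin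
  have : Finite (X ≃ₜ X) := Finite.of_injective _ (DFunLike.coe_injective (F := X ≃ₜ X))
  exact not_injective_infinite_finite g hg

/-- **AFP coding for `G`-limit points.** Suppose `G₁` and `G₂` are
geometrically finite and `x ∈ Λ(G) ∖ ⋃_{g ∈ G} g (Λ(G₁) ∪ Λ(G₂))`. Then there is a
sequence `(g k)` of letters in `(G₁ ∪ G₂) ∖ J` (index `c = 0` stands for `G₁`,
`c = 1` for `G₂`), whose types alternate — so that each partial product
`h k = g 0 * ⋯ * g k` is a normal form of length `k + 1` — and such that whenever
`g k ∈ G_c ∖ J` one has `x ∈ h k '' B_c`. -/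
theorem statement_15 {M : Type*} [TopologicalSpace M] [CompactSpace M]
    [TopologicalSpace.MetrizableSpace M]
    (G₁ G₂ J G : Subgroup (M ≃ₜ M))
    (hd₁ : IsDiscreteConvGroup G₁) (hd₂ : IsDiscreteConvGroup G₂)
    (hJ : J = G₁ ⊓ G₂) (hJgf : IsGeomFinite J) (hJlt₁ : J < G₁) (hJlt₂ : J < G₂)
    (B₁ B₂ : Set M) (hpp : AFPPingPong G₁ G₂ J B₁ B₂)
    (hG : G = G₁ ⊔ G₂) (hGconv : IsConvGroup G)
    (hgf₁ : IsGeomFinite G₁) (hgf₂ : IsGeomFinite G₂)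
    (x : M) (hx : x ∈ limitSet G \ ⋃ g ∈ G, ⇑g '' (limitSet G₁ ∪ limitSet G₂)) :
    ∃ g h : ℕ → M ≃ₜ M,
      (∀ k, AFPLetter G₁ G₂ J 0 (g k) ∨ AFPLetter G₁ G₂ J 1 (g k)) ∧
      (∀ k, ∀ c : Fin 2, AFPLetter G₁ G₂ J c (g k) → AFPLetter G₁ G₂ J (1 - c) (g (k + 1))) ∧
      h 0 = g 0 ∧ (∀ k, h (k + 1) = h k * g (k + 1)) ∧
      (∀ k, ∀ c : Fin 2, AFPLetter G₁ G₂ J c (g k) →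
        x ∈ ⇑(h k) '' (if c = 0 then B₁ else B₂)) := by
  obtain ⟨hxG, hxU⟩ := hx
  have := infinite_of_mem_limitSet hxG
  let _ := TopologicalSpace.metrizableSpaceMetric M
  subst hG
  let Γ : Fin 2 → Subgroup (M ≃ₜ M) := fun i => if i = 0 then G₁ else G₂
  let B : Fin 2 → Set M := fun i => if i = 0 then B₁ else B₂
  have hdisj : Disjoint (interior B₁) (interior B₂) := disjoint_iff_inter_eq_empty.2 hpp.int_disjoint
  have hP : ∀ i, PingPongSets (Γ i) J (closure (interior (B i))) (interior (B (1 - i))) :=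
    Fin.forall_fin_two.2
      ⟨pingPongSets_closure_interior hJlt₁ hpp.isClosed₁ hpp.int_nonempty₁ hdisj hpp.inv₁ hpp.pp₁
        hpp.lim₁,
      pingPongSets_closure_interior hJlt₂ hpp.isClosed₂ hpp.int_nonempty₂ hdisj.symm hpp.inv₂
        hpp.pp₂ hpp.lim₂⟩
  have hB : ∀ i, IsClosed (B i) := Fin.forall_fin_two.2 ⟨hpp.isClosed₁, hpp.isClosed₂⟩
  have hxΓ : ∀ g ∈ Γ 0 ⊔ Γ 1, ∀ i, g x ∉ limitSet (Γ i) := by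
    refine fun g hg i hi => hxU (mem_iUnion₂.2 ⟨g⁻¹, inv_mem hg, g x, ?_, inv_app_self g x⟩)
    revert hi
    exact (Fin.forall_fin_two (p := fun i => g x ∈ limitSet (Γ i) → _)).2 ⟨Or.inl, Or.inr⟩ i
  obtain ⟨g, f, i, hgΓ, hgJ, hi, h0, hs, hC⟩ := exists_coding (O := fun i => interior (B i)) hP
    (fun i => subset_closure) (fun i => isOpen_interior)
    (Fin.forall_fin_two.2 ⟨hpp.int_nonempty₁, hpp.int_nonempty₂⟩)
    (Fin.forall_fin_two.2 ⟨hd₁, hd₂⟩) (Fin.forall_fin_two.2 ⟨hgf₁, hgf₂⟩) hJgf hxG hxΓ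
  have hg : ∀ k, AFPLetter G₁ G₂ J (i k) (g k) := fun k => ⟨hgΓ k, hgJ k⟩
  have huniq : ∀ k c, AFPLetter G₁ G₂ J c (g k) → c = i k := by
    intro k c hc
    have h1 := hgΓ k
    have h2 := hgJ k
    rw [hJ, Subgroup.mem_inf] at h2
    refine (fin_two_eq_or (i k) c).resolve_right fun he => h2 ?_
    have h3 := hc.1
    rw [he] at h3
    obtain hk | hk := fin_two_eq_or 0 (i k)
    · rw [hk] at h1 h3
      exact ⟨h1, h3⟩
    · rw [hk] at h1 h3
      exact ⟨h3, h1⟩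
  refine ⟨g, f, fun k => ?_, fun k c hc => ?_, h0, hs, fun k c hc => ?_⟩
  · obtain hk | hk := fin_two_eq_or 0 (i k)
    · exact Or.inl (hk ▸ hg k)
    · rw [sub_zero] at hk
      exact Or.inr (hk ▸ hg k)
  · rw [huniq k c hc, ← hi k]
    exact hg (k + 1)
  · rw [huniq k c hc]
    exact ⟨(f k)⁻¹ x, closure_minimal interior_subset (hB _) (hC k), app_inv_self _ _⟩

end ConvergenceGroups
end
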